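/- For every δ > 0 there exist ε > 0 and n₀ ∈ ℕ such that for every p ∈ (0,1] and every n ≥ n₀ the following holds. Let G be a (p,λ)-bijumbled graph on n vertices with λ ≤ ε p² n / log n and minimum degree δ(G) ≥ δ p n, and let ℓ₁, …, ℓ_t ≥ 3 be integers with ℓ₁ + ⋯ + ℓ_t = n. Then G contains t vertex-disjoint cycles of lengths ℓ₁, …, ℓ_t covering all n vertices of G (i.e., G contains any prescribed 2-factor F consisting of disjoint cycles whose lengths sum to n). -/

import Mathlib

open Finset

/-- The number of pairs `(a,b) ∈ A × B` with `ab` an edge of `G`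
(edges inside `A ∩ B` are counted twice). -/
def ePairs {V : Type} [DecidableEq V] (G : SimpleGraph V) [DecidableRel G.Adj]
    (A B : Finset V) : ℕ :=
  ((A ×ˢ B).filter fun ab => G.Adj ab.1 ab.2).card

/-- `G` is `(p,λ)`-bijumbled: `|e(A,B) − p|A||B|| < λ√(|A||B|)` for all (nonempty)
vertex subsets `A, B`. -/
def Bijumbled {V : Type} [Fintype V] [DecidableEq V] (G : SimpleGraph V)
    [DecidableRel G.Adj] (p lam : ℝ) : Prop :=
  ∀ A B : Finset V, A.Nonempty → B.Nonempty →
    |(ePairs G A B : ℝ) - p * A.card * B.card| < lam * Real.sqrt (A.card * B.card)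

set_option linter.unusedSectionVars false

/-- The neighbours of `v` inside `Y`. -/
def nb {V : Type} (G : SimpleGraph V) [DecidableRel G.Adj] (v : V) (Y : Finset V) : Finset V :=
  Y.filter fun w => G.Adj v w

section basics

variable {V : Type} [Fintype V] [DecidableEq V] {G : SimpleGraph V} [DecidableRel G.Adj]
  {p lam : ℝ}

theorem mem_nb {v w : V} {Y : Finset V} : w ∈ nb G v Y ↔ w ∈ Y ∧ G.Adj v w := by
  simp [nb]

theorem nb_subset (v : V) (Y : Finset V) : nb G v Y ⊆ Y := filter_subset _ _

theorem nb_mono (v : V) {Y Z : Finset V} (h : Y ⊆ Z) : nb G v Y ⊆ nb G v Z :=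
  filter_subset_filter _ h

theorem card_nb_sdiff (v : V) (Y Z : Finset V) :
    (nb G v Y).card ≤ (nb G v (Y \ Z)).card + (nb G v Z).card := by
  rw [← card_union_of_disjoint]
  · apply card_le_card
    intro w hw
    rw [mem_nb] at hw
    by_cases h : w ∈ Z <;> simp [mem_nb, hw, h]
  · rw [disjoint_left]
    intro a ha hb
    rw [mem_nb] at ha hb
    exact (mem_sdiff.1 ha.1).2 hb.1

theorem ePairs_eq_sum (A B : Finset V) : ePairs G A B = ∑ a ∈ A, (nb G a B).card := by
  rw [ePairs, card_filter, sum_product]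
  exact sum_congr rfl fun a _ => (card_filter _ _).symm

theorem Bijumbled.lam_pos [Nonempty V] (h : Bijumbled G p lam) (hp : 0 < p) : p < lam := by
  obtain ⟨v⟩ := ‹Nonempty V›
  have := h {v} {v} (by simp) (by simp)
  simpa [ePairs_eq_sum, nb, filter_singleton, abs_of_pos hp] using this

theorem card_mul_sq_le_of_high_degree (h : Bijumbled G p lam) {X Q : Finset V}
    {D : ℝ} (hD : 0 < D) (hQ : 2 * p * Q.card ≤ D) (hX : ∀ x ∈ X, D ≤ ((nb G x Q).card : ℝ)) :
    X.card * D ^ 2 ≤ 4 * lam ^ 2 * Q.card := by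
  rcases X.eq_empty_or_nonempty with rfl | hXn
  · simp; positivity
  rcases Q.eq_empty_or_nonempty with rfl | hQn
  · obtain ⟨x, hx⟩ := hXn
    have := hX x hx
    simp [nb] at this
    linarith
  have h1 := (abs_lt.1 (h X Q hXn hQn)).2
  rw [ePairs_eq_sum] at h1
  push_cast at h1
  have h2 : X.card * D ≤ ∑ a ∈ X, ((nb G a Q).card : ℝ) := by
    rw [← nsmul_eq_mul]
    exact card_nsmul_le_sum _ _ _ hX
  have hXc : (0 : ℝ) < X.card := by exact_mod_cast hXn.card_pos
  have hQc : (0 : ℝ) < Q.card := by exact_mod_cast hQn.card_pos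
  set s := Real.sqrt (X.card * Q.card)
  have hs : s ^ 2 = X.card * Q.card := Real.sq_sqrt (by positivity)
  have h3 : X.card * D ≤ 2 * (lam * s) := by nlinarith
  have h4 : (X.card * D) ^ 2 ≤ (2 * (lam * s)) ^ 2 := by
    apply pow_le_pow_left₀ (by positivity) h3
  have h5 : (2 * (lam * s)) ^ 2 = 4 * lam ^ 2 * Q.card * X.card := by
    rw [mul_pow, mul_pow, hs]; ring
  rw [h5] at h4
  have : X.card * D ^ 2 * X.card ≤ 4 * lam ^ 2 * Q.card * X.card := by linarith
  exact le_of_mul_le_mul_right this hXc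

theorem card_mul_card_le_of_low_degree (h : Bijumbled G p lam) (hp : 0 < p) {X Y : Finset V}
    (hX : ∀ x ∈ X, ((nb G x Y).card : ℝ) ≤ p * Y.card / 2) :
    p ^ 2 * X.card * Y.card ≤ 4 * lam ^ 2 := by
  rcases X.eq_empty_or_nonempty with rfl | hXn
  · simp; positivity
  rcases Y.eq_empty_or_nonempty with rfl | hQn
  · simp; positivity
  have h1 := (abs_lt.1 (h X Y hXn hQn)).1
  rw [ePairs_eq_sum] at h1
  push_cast at h1
  have h2 : ∑ a ∈ X, ((nb G a Y).card : ℝ) ≤ X.card * (p * Y.card / 2) := by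
    rw [← nsmul_eq_mul]
    exact sum_le_card_nsmul _ _ _ hX
  have hXc : (0 : ℝ) < X.card := by exact_mod_cast hXn.card_pos
  have hQc : (0 : ℝ) < Y.card := by exact_mod_cast hQn.card_pos
  set s := Real.sqrt (X.card * Y.card)
  have hs : s ^ 2 = X.card * Y.card := Real.sq_sqrt (by positivity)
  have h3 : p * (X.card * Y.card) ≤ 2 * (lam * s) := by nlinarith
  have h4 : (p * (X.card * Y.card)) ^ 2 ≤ (2 * (lam * s)) ^ 2 :=
    pow_le_pow_left₀ (by positivity) h3 2
  have h5 : (2 * (lam * s)) ^ 2 = 4 * lam ^ 2 * (X.card * Y.card) := by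
    rw [mul_pow, mul_pow, hs]; ring
  rw [h5] at h4
  have : p ^ 2 * X.card * Y.card * (X.card * Y.card) ≤ 4 * lam ^ 2 * (X.card * Y.card) := by
    nlinarith
  exact le_of_mul_le_mul_right this (by positivity)

end basics

section potential

theorem exists_card_eq_of_potential {E ι : Type} [DecidableEq E] (Valid : Finset E → Prop) (𝒳 : Finset ι)
    (miss : ι → E → Prop) [∀ X, DecidablePred (miss X)] (K m : ℕ) (h0 : Valid ∅)
    (hstep : ∀ M : Finset E, Valid M → M.card < m → ∃ PP : Finset E, PP.Nonempty ∧
      (∀ e ∈ PP, e ∉ M ∧ Valid (insert e M)) ∧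
      ∀ X ∈ 𝒳, (PP.filter (miss X)).card * 2 ^ K ≤ PP.card) :
    ∃ M : Finset E, Valid M ∧ M.card = m ∧
      ∀ X ∈ 𝒳, 2 ^ (K * (M.filter (miss X)).card) ≤ 𝒳.card * 2 ^ m := by
  suffices H : ∀ j ≤ m, ∃ M : Finset E, Valid M ∧ M.card = j ∧
      ∑ X ∈ 𝒳, 2 ^ (K * (M.filter (miss X)).card) ≤ 𝒳.card * 2 ^ j by
    obtain ⟨M, hM, hc, hs⟩ := H m le_rfl
    refine ⟨M, hM, hc, fun X hX => le_trans ?_ hs⟩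
    exact single_le_sum (f := fun X => 2 ^ (K * (M.filter (miss X)).card))
      (fun _ _ => Nat.zero_le _) hX
  intro j
  induction j with
  | zero => intro _; exact ⟨∅, h0, by simp, by simp⟩
  | succ j ih =>
    intro hj
    obtain ⟨M, hM, hc, hs⟩ := ih (by omega)
    obtain ⟨PP, hne, hPP, hX⟩ := hstep M hM (by omega)
    have key : ∑ e ∈ PP, ∑ X ∈ 𝒳, 2 ^ (K * ((insert e M).filter (miss X)).card) ≤
        ∑ e ∈ PP, 2 * ∑ X ∈ 𝒳, 2 ^ (K * (M.filter (miss X)).card) := by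
      rw [sum_comm, sum_const, smul_eq_mul, mul_left_comm, ← mul_assoc, mul_sum]
      refine sum_le_sum fun X hXX => ?_
      have h1 : ∀ e ∈ PP, 2 ^ (K * ((insert e M).filter (miss X)).card) ≤
          2 ^ (K * (M.filter (miss X)).card) * ((if miss X e then 2 ^ K else 0) + 1) := by
        intro e he
        have hnot : e ∉ M.filter (miss X) := fun h => (hPP e he).1 (mem_filter.1 h).1
        rw [filter_insert]
        split_ifs with hm
        · rw [card_insert_of_notMem hnot, mul_add, pow_add, mul_one]
          exact Nat.mul_le_mul_left _ (Nat.le_succ _)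
        · simp
      refine (sum_le_sum h1).trans ?_
      rw [← mul_sum, mul_comm, sum_add_distrib, ← sum_filter, sum_const, sum_const]
      refine Nat.mul_le_mul_right _ ?_
      simp only [smul_eq_mul, mul_one, two_mul]
      refine Nat.add_le_add_right ?_ _
      exact hX X hXX
    obtain ⟨e, he, hle⟩ := exists_le_of_sum_le hne key
    refine ⟨insert e M, (hPP e he).2, by rw [card_insert_of_notMem (hPP e he).1, hc], ?_⟩
    refine hle.trans ?_
    rw [pow_succ]
    nlinarith

end potential

section split

/-- A uniformly random subset splits each of few large finite sets fairly: some subset meets each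
of them, and misses each of them, in at least a quarter of its elements. -/
theorem exists_balanced_subset {V ι : Type} [Fintype V] [DecidableEq V] (𝒩 : Finset ι)
    (N : ι → Finset V) (k : ι → ℕ)
    (hk : ∀ i ∈ 𝒩, 2 * 𝒩.card * 2 ^ k i * 3 ^ (N i).card < 4 ^ (N i).card) :
    ∃ X : Finset V, ∀ i ∈ 𝒩, k i ≤ (N i ∩ X).card ∧ k i ≤ (N i \ X).card := by
  by_contra! hcon
  have hsum : ∀ S : Finset V, (∑ X : Finset V, (1 / 2 : ℝ) ^ (S ∩ X).card) =
      (3 / 4) ^ S.card * 2 ^ Fintype.card V := by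
    intro S
    have h1 := Finset.prod_add_one (f := fun v : V => if v ∈ S then (1 / 2 : ℝ) else 1)
      (s := Finset.univ)
    rw [powerset_univ] at h1
    have h2 : ∀ X : Finset V, ∏ v ∈ X, (if v ∈ S then (1 / 2 : ℝ) else 1) =
        (1 / 2) ^ (S ∩ X).card := by
      intro X
      rw [prod_ite, prod_const, prod_const_one, mul_one, inter_comm, filter_mem_eq_inter]
    simp only [h2] at h1
    rw [← h1]
    have h3 : ∀ v : V, ((if v ∈ S then (1 / 2 : ℝ) else 1) + 1) =
        (if v ∈ S then (3 / 4 : ℝ) else 1) * 2 := by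
      intro v; split_ifs <;> norm_num
    simp only [h3]
    rw [prod_mul_distrib, prod_ite, prod_const, prod_const, prod_const]
    simp
  have hsum' : ∀ S : Finset V, (∑ X : Finset V, (1 / 2 : ℝ) ^ (S \ X).card) =
      (3 / 4) ^ S.card * 2 ^ Fintype.card V := by
    intro S
    rw [← hsum S]
    refine Fintype.sum_equiv (Equiv.ofBijective (fun X : Finset V => Xᶜ)
      compl_bijective) _ _ fun X => ?_
    simp [sdiff_eq_inter_compl]
  have hlow : ∀ X : Finset V, (1 : ℝ) ≤
      ∑ i ∈ 𝒩, 2 ^ k i * ((1 / 2) ^ (N i ∩ X).card + (1 / 2) ^ (N i \ X).card) := by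
    intro X
    obtain ⟨i, hi, hX⟩ := hcon X
    have hterm : (1 : ℝ) ≤ 2 ^ k i * ((1 / 2) ^ (N i ∩ X).card + (1 / 2) ^ (N i \ X).card) := by
      have aux : ∀ a : ℕ, a < k i → (1 : ℝ) ≤ 2 ^ k i * (1 / 2) ^ a := by
        intro a ha
        rw [one_div, inv_pow, ← div_eq_mul_inv, le_div_iff₀ (by positivity), one_mul]
        exact pow_le_pow_right₀ (by norm_num) ha.le
      rw [mul_add]
      by_cases h : k i ≤ (N i ∩ X).card
      · have := aux _ (hX h)
        have : (0 : ℝ) ≤ 2 ^ k i * (1 / 2) ^ (N i ∩ X).card := by positivity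
        linarith
      · have := aux _ (not_le.1 h)
        have : (0 : ℝ) ≤ 2 ^ k i * (1 / 2) ^ (N i \ X).card := by positivity
        linarith
    refine hterm.trans (single_le_sum (f := fun i => (2 : ℝ) ^ k i *
      ((1 / 2) ^ (N i ∩ X).card + (1 / 2) ^ (N i \ X).card)) (fun _ _ => by positivity) hi)
  have hne : 𝒩.Nonempty := by
    obtain ⟨i, hi, -⟩ := hcon ∅
    exact ⟨i, hi⟩
  have htot := sum_le_sum fun (X : Finset V) (_ : X ∈ univ) => hlow X
  rw [sum_comm] at htot
  simp only [← mul_sum, sum_add_distrib, hsum, hsum'] at htot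
  simp only [sum_const, card_univ, Fintype.card_finset, nsmul_eq_mul, mul_one] at htot
  have hcard : (0 : ℝ) < 𝒩.card := by exact_mod_cast hne.card_pos
  have hpow : (0 : ℝ) < 2 ^ Fintype.card V := by positivity
  have hlt : ∑ i ∈ 𝒩, (2 : ℝ) ^ k i * ((3 / 4) ^ (N i).card * 2 ^ Fintype.card V +
      (3 / 4) ^ (N i).card * 2 ^ Fintype.card V) < ∑ i ∈ 𝒩, 2 ^ Fintype.card V / (𝒩.card : ℝ) := by
    refine sum_lt_sum_of_nonempty hne fun i hi => ?_
    rw [lt_div_iff₀ hcard]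
    have h := hk i hi
    have h' : (2 : ℝ) * 𝒩.card * 2 ^ k i * 3 ^ (N i).card < 4 ^ (N i).card := by exact_mod_cast h
    rw [div_pow]
    have h4 : (0 : ℝ) < 4 ^ (N i).card := by positivity
    have h5 : (2 : ℝ) * 𝒩.card * 2 ^ k i * (3 ^ (N i).card / 4 ^ (N i).card) < 1 := by
      rw [← mul_div_assoc, div_lt_one h4]; exact h'
    nlinarith
  rw [sum_const, nsmul_eq_mul, mul_div_cancel₀ _ hcard.ne'] at hlt
  push_cast at htot
  linarith

end split

section absorber

/-- Robust matching: after removing small exceptional sets, every admissible set `U` of the right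
size can be matched perfectly to the remaining gadgets. -/
theorem exists_flexible_matching {V E : Type} [Fintype V] [DecidableEq V] [DecidableEq E] (M : Finset E)
    (U₀ : Finset V) (hit : V → E → Prop)
    [∀ v e, Decidable (hit v e)] (s z : ℕ)
    (hL : ∀ X : Finset V, s ≤ X.card → (M.filter fun e => ∀ v ∈ X, ¬ hit v e).card ≤ z)
    (hM : 2 * s + 2 * z < M.card) (hU : 2 * s + 2 * z ≤ U₀.card) :
    ∃ (S : Finset V) (T : Finset E), S.card ≤ s ∧ T ⊆ M ∧ T.card ≤ z ∧
      ∀ U : Finset V, U₀ \ S ⊆ U → Disjoint U S → U.card + T.card = M.card →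
        ∃ f : E → V, (∀ e ∈ M \ T, f e ∈ U ∧ hit (f e) e) ∧ Set.InjOn f (M \ T : Finset E) := by
  let NM : Finset V → Finset E := fun S => M.filter fun e => ∃ v ∈ S, hit v e
  let NU : Finset E → Finset V := fun T => U₀.filter fun v => ∃ e ∈ T, hit v e
  let C : Finset (Finset V × Finset E) := (univ ×ˢ M.powerset).filter fun q =>
    (NM q.1 \ q.2).card ≤ q.1.card ∧ (NU q.2 \ q.1).card ≤ q.2.card ∧ q.1.card ≤ s ∧ q.2.card ≤ z
  have hC : C.Nonempty := ⟨(∅, ∅), by simp [C, NM, NU]⟩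
  obtain ⟨⟨S, T⟩, hST, hmax⟩ := exists_max_image C (fun q => q.1.card + q.2.card) hC
  simp only [C, mem_filter, mem_product, mem_univ, true_and, mem_powerset] at hST hmax
  obtain ⟨hTM, h1, h2, h3, h4⟩ := hST
  have hmiss : ∀ X : Finset V, s ≤ X.card → M.card ≤ (NM X).card + z := by
    intro X hX
    have e1 := card_filter_add_card_filter_not (s := M) (fun e => ∃ v ∈ X, hit v e)
    have e2 := hL X hX
    have e3 : (M.filter fun e => ¬ ∃ v ∈ X, hit v e) = M.filter fun e => ∀ v ∈ X, ¬ hit v e := by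
      apply filter_congr
      intro e _
      push Not
      rfl
    rw [e3] at e1
    simp only [NM]
    omega
  have hTviol : ∀ T' ⊆ M \ T, T'.card ≤ z →
      T'.card ≤ ((U₀ \ S).filter fun v => ∃ e ∈ T', hit v e).card := by
    intro T' hT' hz
    by_contra! hlt
    have hdis : Disjoint T T' := (disjoint_of_subset_left hT' sdiff_disjoint).symm
    have hcard : (T ∪ T').card = T.card + T'.card := card_union_of_disjoint hdis
    have hsub : NU (T ∪ T') \ S ⊆ (NU T \ S) ∪ ((U₀ \ S).filter fun v => ∃ e ∈ T', hit v e) := by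
      intro v hv
      simp only [NU, mem_sdiff, mem_filter, mem_union] at hv ⊢
      obtain ⟨⟨hv1, e, he | he, hh⟩, hv2⟩ := hv
      · exact Or.inl ⟨⟨hv1, e, he, hh⟩, hv2⟩
      · exact Or.inr ⟨⟨hv1, hv2⟩, e, he, hh⟩
    have hc2 := (card_le_card hsub).trans (card_union_le _ _)
    have hTT : T ∪ T' ⊆ M := union_subset hTM (hT'.trans sdiff_subset)
    by_cases hcase : (T ∪ T').card ≤ z
    · have := hmax (S, T ∪ T') ⟨hTT, (card_le_card (sdiff_subset_sdiff le_rfl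
        subset_union_left)).trans h1, by dsimp only; omega, h3, hcase⟩
      simp only at this
      omega
    · let X := (U₀ \ S) \ (NU (T ∪ T') \ S)
      have hX : s ≤ X.card := by
        have a1 := le_card_sdiff (NU (T ∪ T') \ S) (U₀ \ S)
        have a2 := le_card_sdiff S U₀
        simp only [X]
        omega
      have := hL X hX
      have hsub2 : T ∪ T' ⊆ M.filter fun e => ∀ v ∈ X, ¬ hit v e := by
        intro e he
        refine mem_filter.2 ⟨hTT he, fun v hv hh => ?_⟩
        simp only [X, NU, mem_sdiff, mem_filter] at hv
        exact hv.2 ⟨⟨hv.1.1, e, he, hh⟩, hv.1.2⟩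
      have := card_le_card hsub2
      omega
  have hSviol : ∀ S' : Finset V, Disjoint S' S → S'.card ≤ s →
      S'.card ≤ ((M \ T).filter fun e => ∃ v ∈ S', hit v e).card := by
    intro S' hS' hs
    by_contra! hlt
    have hcard : (S ∪ S').card = S.card + S'.card := card_union_of_disjoint hS'.symm
    have hsub : NM (S ∪ S') \ T ⊆ (NM S \ T) ∪ ((M \ T).filter fun e => ∃ v ∈ S', hit v e) := by
      intro e he
      simp only [NM, mem_sdiff, mem_filter, mem_union] at he ⊢
      obtain ⟨⟨hv1, v, hv | hv, hh⟩, hv2⟩ := he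
      · exact Or.inl ⟨⟨hv1, v, hv, hh⟩, hv2⟩
      · exact Or.inr ⟨⟨hv1, hv2⟩, v, hv, hh⟩
    have hc2 := (card_le_card hsub).trans (card_union_le _ _)
    by_cases hcase : (S ∪ S').card ≤ s
    · have := hmax (S ∪ S', T) ⟨hTM, by dsimp only; omega, (card_le_card (sdiff_subset_sdiff le_rfl
        subset_union_left)).trans h2, hcase, h4⟩
      simp only at this
      omega
    · have a1 := hmiss (S ∪ S') (by omega)
      have a2 := le_card_sdiff T (NM (S ∪ S'))
      omega
  refine ⟨S, T, h3, hTM, h4, fun U hUU hdisj hcardU => ?_⟩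
  have hMT : (M \ T).card + T.card = M.card := card_sdiff_add_card_eq_card hTM
  have hall : ∀ T' ⊆ M \ T, T'.card ≤ (U.filter fun v => ∃ e ∈ T', hit v e).card := by
    intro T' hT'
    by_contra! hlt
    by_cases hz : T'.card ≤ z
    · have := hTviol T' hT' hz
      have := card_le_card (filter_subset_filter (fun v => ∃ e ∈ T', hit v e) hUU)
      omega
    · let S' := U.filter fun v => ¬ ∃ e ∈ T', hit v e
      have e1 : (U.filter fun v => ∃ e ∈ T', hit v e).card + S'.card = U.card :=
        card_filter_add_card_filter_not _
      by_cases hs : s ≤ S'.card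
      · have e2 := hL S' hs
        have : T' ⊆ M.filter fun e => ∀ v ∈ S', ¬ hit v e := by
          intro e he
          refine mem_filter.2 ⟨sdiff_subset (hT' he), fun v hv hh => ?_⟩
          exact (mem_filter.1 hv).2 ⟨e, he, hh⟩
        have := card_le_card this
        omega
      · have e2 := hSviol S' (disjoint_of_subset_left (filter_subset _ _) hdisj) (by omega)
        have e3 : ((M \ T).filter fun e => ∃ v ∈ S', hit v e) ⊆ (M \ T) \ T' := by
          intro e he
          obtain ⟨he1, v, hv, hh⟩ := mem_filter.1 he
          exact mem_sdiff.2 ⟨he1, fun h => (mem_filter.1 hv).2 ⟨e, h, hh⟩⟩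
        have e4 := card_le_card e3
        have e5 := card_sdiff_add_card_eq_card hT'
        omega
  have hHall := (all_card_le_biUnion_card_iff_exists_injective
    (fun e : {e // e ∈ M \ T} => U.filter fun v => hit v e)).1 (by
      intro T'
      have := hall (T'.map (Function.Embedding.subtype _)) (by
        intro e he
        obtain ⟨a, -, rfl⟩ := mem_map.1 he
        exact a.2)
      rw [card_map] at this
      refine this.trans (card_le_card ?_)
      intro v hv
      obtain ⟨hv1, e, he, hh⟩ := mem_filter.1 hv
      obtain ⟨a, ha, rfl⟩ := mem_map.1 he
      exact mem_biUnion.2 ⟨a, ha, mem_filter.2 ⟨hv1, hh⟩⟩)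
  obtain ⟨f, hinj, hf⟩ := hHall
  by_cases hne : Nonempty V
  · refine ⟨fun e => if h : e ∈ M \ T then f ⟨e, h⟩ else Classical.arbitrary V, ?_, ?_⟩
    · intro e he
      simp only [dif_pos he]
      exact mem_filter.1 (hf ⟨e, he⟩)
    · intro a ha b hb hab
      simp only [mem_coe] at ha hb
      simp only [dif_pos ha, dif_pos hb] at hab
      simpa using hinj hab
  · exfalso
    have : M.Nonempty := card_pos.1 (by omega)
    have h0 : U.card = 0 := by
      rw [card_eq_zero, eq_empty_iff_forall_notMem]
      intro v; exact (hne ⟨v⟩).elim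
    omega

end absorber

section connecting

variable {V : Type} [Fintype V] [DecidableEq V] {G : SimpleGraph V} [DecidableRel G.Adj]

/-- Any two sets of size `b` span an edge, and every set of size `b` contains a vertex with `2b`
neighbours in any given set of size `y`. -/
structure Expands (G : SimpleGraph V) [DecidableRel G.Adj] (b y : ℕ) : Prop where
  edge : ∀ A B : Finset V, b ≤ A.card → b ≤ B.card → ∃ u ∈ A, ∃ w ∈ B, G.Adj u w
  deg : ∀ A Y : Finset V, b ≤ A.card → y ≤ Y.card → ∃ u ∈ A, 2 * b ≤ (nb G u Y).card

/-- `c` lists the `k` interior vertices, all in `Y`, of a path from `u` to `w`. -/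
structure Linked (G : SimpleGraph V) (u w : V) (k : ℕ) (Y : Finset V) (c : List V) : Prop where
  nodup : c.Nodup
  length : c.length = k
  mem : ∀ x ∈ c, x ∈ Y
  chain : (u :: (c ++ [w])).IsChain G.Adj

theorem Linked.mono {u w : V} {k : ℕ} {Y Z : Finset V} {c : List V} (h : Linked G u w k Y c)
    (hYZ : Y ⊆ Z) : Linked G u w k Z c :=
  ⟨h.nodup, h.length, fun x hx => hYZ (h.mem x hx), h.chain⟩

theorem Expands.exists_path {b y : ℕ} (hG : Expands G b y) (k : ℕ) (hk : 2 ≤ k) :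
    ∀ A B Y : Finset V, A ⊆ Y → B ⊆ Y → Disjoint A B → b ≤ A.card → b ≤ B.card →
      k + y ≤ (Y \ B).card → ∃ l : List V, l.Nodup ∧ l.length = k ∧ (∀ x ∈ l, x ∈ Y) ∧
        l.IsChain G.Adj ∧ (∀ a ∈ l.head?, a ∈ A) ∧ ∀ a ∈ l.getLast?, a ∈ B := by
  induction k, hk using Nat.le_induction with
  | base =>
    intro A B Y hA hB _ hAc hBc _
    obtain ⟨a, ha, b, hb, hab⟩ := hG.edge A B hAc hBc
    exact ⟨[a, b], by simp [hab.ne], by simp, by simp [hA ha, hB hb], by simp [hab],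
      by simp [ha], by simp [hb]⟩
  | succ k hk ih =>
    intro A B Y hA hB hdis hAc hBc hY
    obtain ⟨x, hx, hdeg⟩ := hG.deg A (Y \ B) hAc (by omega)
    have hxB : x ∉ B := disjoint_left.1 hdis hx
    have hxn : x ∉ nb G x (Y \ B) := fun h => G.irrefl (mem_nb.1 h).2
    obtain ⟨l, hl1, hl2, hl3, hl4, hl5, hl6⟩ := ih (nb G x (Y \ B)) B (Y \ {x})
      (fun v hv => by
        have := nb_subset x (Y \ B) hv
        simp only [mem_sdiff, mem_singleton] at this ⊢
        exact ⟨this.1, fun h => hxn (h ▸ hv)⟩)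
      (fun v hv => by
        simp only [mem_sdiff, mem_singleton]
        exact ⟨hB hv, fun h => hxB (h ▸ hv)⟩)
      (disjoint_of_subset_left (nb_subset _ _) sdiff_disjoint) (by omega) hBc
      (by
        have h1 : (Y \ {x}) \ B = (Y \ B).erase x := by
          ext v; simp only [mem_sdiff, mem_singleton, mem_erase]; tauto
        rw [h1]
        have := pred_card_le_card_erase (s := Y \ B) (a := x)
        omega)
    refine ⟨x :: l, ?_, by simp [hl2], ?_, ?_, by simp [hx], ?_⟩
    · refine List.nodup_cons.2 ⟨fun h => ?_, hl1⟩
      have := hl3 x h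
      simp at this
    · intro v hv
      rcases List.mem_cons.1 hv with rfl | hv
      · exact hA hx
      · exact sdiff_subset (hl3 v hv)
    · refine List.isChain_cons.2 ⟨fun v hv => (mem_nb.1 (hl5 v hv)).2, hl4⟩
    · intro a ha
      apply hl6
      rcases l with _ | ⟨v, l⟩
      · simp at hl2; omega
      · simpa using ha

theorem Expands.exists_linked {b y : ℕ} (hG : Expands G b y) {k : ℕ} (hk : 2 ≤ k) (u w : V)
    (Y : Finset V) (hu : 2 * b ≤ (nb G u Y).card) (hw : b ≤ (nb G w Y).card)
    (hY : k + y + b ≤ Y.card) : ∃ c, Linked G u w k Y c := by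
  obtain ⟨B, hB, hBc⟩ := exists_subset_card_eq hw
  have hA := le_card_sdiff B (nb G u Y)
  have hYB := le_card_sdiff B Y
  obtain ⟨l, hl1, hl2, hl3, hl4, hl5, hl6⟩ := hG.exists_path k hk (nb G u Y \ B) B Y
    (sdiff_subset.trans (nb_subset _ _)) (hB.trans (nb_subset _ _)) sdiff_disjoint (by omega)
    hBc.ge (by omega)
  refine ⟨l, hl1, hl2, hl3, ?_⟩
  rw [← List.cons_append, List.isChain_append]
  refine ⟨List.isChain_cons.2 ⟨fun v hv => (mem_nb.1 (sdiff_subset (hl5 v hv))).2, hl4⟩,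
    by simp, ?_⟩
  intro x hx z hz
  simp only [List.head?_cons, Option.mem_some_iff] at hz
  subst hz
  rcases l with _ | ⟨v, l⟩
  · simp at hl2; omega
  · exact (mem_nb.1 (hB (hl6 x (by simpa using hx)))).2.symm

/-- Greedily embedding disjoint cycles of prescribed lengths in a set with some slack. -/
theorem Expands.exists_cycles {b y : ℕ} (hG : Expands G b y) (L : List ℕ) (hL : ∀ x ∈ L, 3 ≤ x)
    (P : Finset V) (hP : L.sum + y + b ≤ P.card) :
    ∃ cs : List (List V), cs.map List.length = L ∧ cs.flatten.Nodup ∧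
      (∀ x ∈ cs.flatten, x ∈ P) ∧ ∀ c ∈ cs, (c ++ c.take 1).IsChain G.Adj := by
  induction L generalizing P with
  | nil => exact ⟨[], by simp⟩
  | cons a L ih =>
    rw [List.sum_cons] at hP
    have ha := hL a (by simp)
    obtain ⟨v, hv, hdeg⟩ := hG.deg P P (by omega) (by omega)
    have hnb : nb G v (P.erase v) = nb G v P := by
      ext w
      simp only [mem_nb, mem_erase]
      constructor
      · rintro ⟨⟨_, h⟩, h'⟩; exact ⟨h, h'⟩
      · rintro ⟨h, h'⟩; exact ⟨⟨h'.ne', h⟩, h'⟩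
    have hcard := card_erase_of_mem hv
    obtain ⟨c, hc⟩ := hG.exists_linked (k := a - 1) (by omega) v v (P.erase v)
      (by rw [hnb]; exact hdeg) (by rw [hnb]; omega) (by omega)
    have hvc : v ∉ c := fun h => by simpa using hc.mem v h
    have hnd : (v :: c).Nodup := List.nodup_cons.2 ⟨hvc, hc.nodup⟩
    have hsub : (v :: c).toFinset ⊆ P := by
      intro x hx
      rcases List.mem_cons.1 (List.mem_toFinset.1 hx) with rfl | hx
      · exact hv
      · exact erase_subset _ _ (hc.mem x hx)
    have hcc : (v :: c).toFinset.card = a := by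
      rw [List.toFinset_card_of_nodup hnd, List.length_cons, hc.length]; omega
    obtain ⟨cs, h1, h2, h3, h4⟩ := ih (fun x hx => hL x (by simp [hx])) (P \ (v :: c).toFinset)
      (by rw [card_sdiff_of_subset hsub, hcc]; omega)
    refine ⟨(v :: c) :: cs, ?_, ?_, ?_, ?_⟩
    · simp only [List.map_cons, h1, List.length_cons, hc.length]
      congr 1; omega
    · rw [List.flatten_cons, List.nodup_append]
      refine ⟨hnd, h2, fun x hx z hz hxz => ?_⟩
      subst hxz
      exact (mem_sdiff.1 (h3 x hz)).2 (List.mem_toFinset.2 hx)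
    · intro x hx
      rw [List.flatten_cons, List.mem_append] at hx
      rcases hx with hx | hx
      · exact hsub (List.mem_toFinset.2 hx)
      · exact sdiff_subset (h3 x hx)
    · intro d hd
      rcases List.mem_cons.1 hd with rfl | hd
      · simpa using hc.chain
      · exact h4 d hd

/-- Disjoint links for all demands in `J`. -/
structure Linkage {α : Type} (G : SimpleGraph V) (J : Finset α) (u w : α → V) (k : α → ℕ)
    (Y : Finset V) (c : α → List V) : Prop where
  link : ∀ j ∈ J, Linked G (u j) (w j) (k j) Y (c j)
  disj : ∀ i ∈ J, ∀ j ∈ J, i ≠ j → List.Disjoint (c i) (c j)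

variable {α : Type} [DecidableEq α] {u w : α → V} {k : α → ℕ}

theorem Linkage.card_used {J : Finset α} {Y : Finset V} {c : α → List V}
    (h : Linkage G J u w k Y c) (hk : ∀ j ∈ J, k j ≤ 8) :
    (J.biUnion fun j => (c j).toFinset).card ≤ 8 * J.card := by
  rw [mul_comm]
  refine card_biUnion_le_card_mul _ _ _ fun j hj => ?_
  exact (List.toFinset_card_le _).trans (((h.link j hj).length).le.trans (hk j hj))

theorem Linkage.mono {J : Finset α} {Y Z : Finset V} {c : α → List V}
    (h : Linkage G J u w k Y c) (hYZ : Y ⊆ Z) : Linkage G J u w k Z c :=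
  ⟨fun j hj => (h.link j hj).mono hYZ, h.disj⟩

theorem Linkage.union {J J' : Finset α} {Y Z : Finset V} {c c' : α → List V}
    (h : Linkage G J u w k Y c) (h' : Linkage G J' u w k Z c') (hYZ : Disjoint Y Z)
    (hJ : Disjoint J J') :
    Linkage G (J ∪ J') u w k (Y ∪ Z) (fun j => if j ∈ J then c j else c' j) := by
  have hx : ∀ i ∈ J, ∀ j ∈ J', List.Disjoint (c i) (c' j) := fun i hi j hj x hx hx' =>
    disjoint_left.1 hYZ ((h.link i hi).mem x hx) ((h'.link j hj).mem x hx')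
  have hn : ∀ j ∈ J', j ∉ J := fun j hj hj' => disjoint_left.1 hJ hj' hj
  constructor
  · intro j hj
    rcases mem_union.1 hj with hj | hj
    · simpa [hj] using (h.link j hj).mono subset_union_left
    · simpa [hn j hj] using (h'.link j hj).mono subset_union_right
  · intro i hi j hj hij
    rcases mem_union.1 hi with hi | hi <;> rcases mem_union.1 hj with hj | hj
    · simpa [hi, hj] using h.disj i hi j hj hij
    · simpa [hi, hn j hj] using hx i hi j hj
    · simpa [hj, hn i hi] using (hx j hj i hi).symm
    · simpa [hn i hi, hn j hj] using h'.disj i hi j hj hij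

theorem Linkage.extend {b y : ℕ} (hG : Expands G b y) {J : Finset α} {Y : Finset V}
    {c : α → List V} (h : Linkage G J u w k Y c) {j : α} (hj : j ∉ J) (hk : 2 ≤ k j)
    (hu : 2 * b ≤ (nb G (u j) (Y \ J.biUnion fun i => (c i).toFinset)).card)
    (hw : b ≤ (nb G (w j) (Y \ J.biUnion fun i => (c i).toFinset)).card)
    (hY : k j + y + b ≤ (Y \ J.biUnion fun i => (c i).toFinset).card) :
    ∃ c', Linkage G (insert j J) u w k Y c' := by
  obtain ⟨d, hd⟩ := hG.exists_linked hk (u j) (w j) _ hu hw hY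
  refine ⟨Function.update c j d, ?_, ?_⟩
  · intro i hi
    rcases mem_insert.1 hi with rfl | hi
    · simpa using hd.mono sdiff_subset
    · have : i ≠ j := fun h => hj (h ▸ hi)
      simpa [this] using h.link i hi
  · have hx : ∀ i ∈ J, List.Disjoint (c i) d := fun i hi x hx hx' =>
      (mem_sdiff.1 (hd.mem x hx')).2 (mem_biUnion.2 ⟨i, hi, List.mem_toFinset.2 hx⟩)
    have hne : ∀ i ∈ J, i ≠ j := fun i hi h => hj (h ▸ hi)
    intro i hi i' hi' hii
    rcases mem_insert.1 hi with rfl | hi₂ <;> rcases mem_insert.1 hi' with rfl | hi₂'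
    · exact (hii rfl).elim
    · simpa [hne i' hi₂'] using (hx i' hi₂').symm
    · simpa [hne i hi₂] using hx i hi₂
    · simpa [hne i hi₂, hne i' hi₂'] using h.disj i hi₂ i' hi₂' hii

theorem Expands.exists_linkage {b y : ℕ} (hG : Expands G b y) (J : Finset α) (Y : Finset V)
    (hk : ∀ j ∈ J, 2 ≤ k j ∧ k j ≤ 8)
    (hu : ∀ j ∈ J, 2 * b + 8 * J.card ≤ (nb G (u j) Y).card)
    (hw : ∀ j ∈ J, 2 * b + 8 * J.card ≤ (nb G (w j) Y).card)
    (hY : 8 * J.card + 8 + y + b ≤ Y.card) : ∃ c, Linkage G J u w k Y c := by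
  suffices H : ∀ I ⊆ J, ∃ c, Linkage G I u w k Y c from H J le_rfl
  intro I
  induction I using Finset.induction_on with
  | empty => exact fun _ => ⟨fun _ => [], by simp, by simp⟩
  | insert j I hj ih =>
    intro hI
    obtain ⟨c, hc⟩ := ih ((subset_insert _ _).trans hI)
    have hIJ : I ⊆ J := (subset_insert _ _).trans hI
    have hjJ := hI (mem_insert_self j I)
    have hU := hc.card_used fun i hi => (hk i (hIJ hi)).2
    have hIc := card_le_card hIJ
    set Q := I.biUnion fun i => (c i).toFinset with hQ
    have hnQ : ∀ v, (nb G v Q).card ≤ Q.card := fun v => card_le_card (nb_subset _ _)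
    have h1 := card_nb_sdiff (G := G) (u j) Y Q
    have h2 := card_nb_sdiff (G := G) (w j) Y Q
    have h3 := hnQ (u j)
    have h4 := hnQ (w j)
    have h5 := hu j hjJ
    have h6 := hw j hjJ
    have h7 := le_card_sdiff Q Y
    have h8 := hk j hjJ
    exact hc.extend hG hj h8.1 (by rw [← hQ]; omega) (by rw [← hQ]; omega) (by rw [← hQ]; omega)

/-- Two-round connection: most demands are linked greedily inside `Y₁ \ Q₀`; the few demands that
get stuck are linked inside `Y₂`. -/
theorem Expands.exists_linkage_two_rounds {b y : ℕ} (hG : Expands G b y) (J : Finset α)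
    (Y₁ Y₂ Q₀ : Finset V) (D r : ℕ) (hk : ∀ j ∈ J, 2 ≤ k j ∧ k j ≤ 8)
    (hinju : Set.InjOn u J) (hinjw : Set.InjOn w J)
    (hfew : ∀ X Q : Finset V, Q.card ≤ Q₀.card + 8 * J.card →
      (∀ x ∈ X, D ≤ (nb G x Q).card) → X.card ≤ r)
    (hu₁ : ∀ j ∈ J, D + 2 * b ≤ (nb G (u j) Y₁).card)
    (hw₁ : ∀ j ∈ J, D + 2 * b ≤ (nb G (w j) Y₁).card)
    (hY₁ : Q₀.card + 8 * J.card + 8 + y + b ≤ Y₁.card)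
    (hu₂ : ∀ j ∈ J, 2 * b + 16 * r ≤ (nb G (u j) Y₂).card)
    (hw₂ : ∀ j ∈ J, 2 * b + 16 * r ≤ (nb G (w j) Y₂).card)
    (hY₂ : 16 * r + 8 + y + b ≤ Y₂.card) (hdis : Disjoint (Y₁ \ Q₀) Y₂) :
    ∃ c, Linkage G J u w k (Y₁ \ Q₀ ∪ Y₂) c ∧
      ((J.biUnion fun j => (c j).toFinset) ∩ Y₂).card ≤ 16 * r := by
  classical
  let C := J.powerset.filter fun I => ∃ c, Linkage G I u w k (Y₁ \ Q₀) c
  have hC : C.Nonempty := ⟨∅, by simpa [C] using ⟨fun _ => [], by simp, by simp⟩⟩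
  obtain ⟨I, hI, hmax⟩ := exists_max_image C card hC
  simp only [C, mem_filter, mem_powerset] at hI hmax
  obtain ⟨hIJ, c, hc⟩ := hI
  have hU := hc.card_used fun i hi => (hk i (hIJ hi)).2
  have hIc := card_le_card hIJ
  set R := I.biUnion fun i => (c i).toFinset with hR
  set Q := Q₀ ∪ R with hQ
  have hQc : Q.card ≤ Q₀.card + 8 * J.card := (card_union_le _ _).trans (by omega)
  have hYQ : (Y₁ \ Q₀) \ R = Y₁ \ Q := by rw [hQ, sdiff_sdiff_left]; rfl
  have hstuck : ∀ j ∈ J \ I, D ≤ (nb G (u j) Q).card ∨ D ≤ (nb G (w j) Q).card := by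
    intro j hj
    obtain ⟨hjJ, hjI⟩ := mem_sdiff.1 hj
    by_contra! hlt
    have h1 := card_nb_sdiff (G := G) (u j) Y₁ Q
    have h2 := card_nb_sdiff (G := G) (w j) Y₁ Q
    have h3 := hu₁ j hjJ
    have h4 := hw₁ j hjJ
    have h5 := le_card_sdiff Q Y₁
    have h6 := hk j hjJ
    obtain ⟨c', hc'⟩ := hc.extend hG hjI h6.1 (by rw [hYQ]; omega) (by rw [hYQ]; omega)
      (by rw [hYQ]; omega)
    have := hmax (insert j I) ⟨insert_subset hjJ hIJ, c', hc'⟩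
    rw [card_insert_of_notMem hjI] at this
    omega
  have hleft : (J \ I).card ≤ 2 * r := by
    have hsub : J \ I ⊆ ((J \ I).filter fun j => D ≤ (nb G (u j) Q).card) ∪
        ((J \ I).filter fun j => D ≤ (nb G (w j) Q).card) := by
      intro j hj
      rcases hstuck j hj with h | h
      · exact mem_union_left _ (mem_filter.2 ⟨hj, h⟩)
      · exact mem_union_right _ (mem_filter.2 ⟨hj, h⟩)
    have aux : ∀ f : α → V, Set.InjOn f J →
        ((J \ I).filter fun j => D ≤ (nb G (f j) Q).card).card ≤ r := by
      intro f hf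
      rw [← card_image_of_injOn (f := f)]
      · refine hfew _ Q hQc fun x hx => ?_
        obtain ⟨j, hj, rfl⟩ := mem_image.1 hx
        exact (mem_filter.1 hj).2
      · refine hf.mono fun j hj => ?_
        exact (mem_sdiff.1 (mem_filter.1 hj).1).1
    have := (card_le_card hsub).trans (card_union_le _ _)
    have := aux u hinju
    have := aux w hinjw
    omega
  obtain ⟨c', hc'⟩ := hG.exists_linkage (u := u) (w := w) (k := k) (J \ I) Y₂
    (fun j hj => hk j (sdiff_subset hj))
    (fun j hj => by have := hu₂ j (sdiff_subset hj); omega)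
    (fun j hj => by have := hw₂ j (sdiff_subset hj); omega) (by omega)
  have hall := hc.union hc' hdis disjoint_sdiff
  rw [union_sdiff_of_subset hIJ] at hall
  refine ⟨_, hall, ?_⟩
  have hused := hc'.card_used fun j hj => (hk j (sdiff_subset hj)).2
  refine (card_le_card (t := (J \ I).biUnion fun j => (c' j).toFinset) ?_).trans (by omega)
  intro x hx
  obtain ⟨hx1, hx2⟩ := mem_inter.1 hx
  obtain ⟨j, hj, hxj⟩ := mem_biUnion.1 hx1
  by_cases hjI : j ∈ I
  · simp only [hjI, if_true, List.mem_toFinset] at hxj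
    exact (disjoint_left.1 hdis ((hc.link j hjI).mem x hxj) hx2).elim
  · simp only [hjI, if_false] at hxj
    exact mem_biUnion.2 ⟨j, mem_sdiff.2 ⟨hj, hjI⟩, hxj⟩

end connecting

section assembly

variable {V : Type} [Fintype V] [DecidableEq V] {G : SimpleGraph V} [DecidableRel G.Adj]

theorem exists_cycle_of_isChain {c : List V} (hl : 3 ≤ c.length) (hnd : c.Nodup)
    (hc : (c ++ c.take 1).IsChain G.Adj) :
    ∃ (v : V) (w : G.Walk v v), w.IsCycle ∧ w.length = c.length ∧ ∀ x, x ∈ w.support ↔ x ∈ c := by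
  rcases c with _ | ⟨a, _ | ⟨b, l⟩⟩
  · simp at hl
  · simp at hl
  simp only [List.take_succ_cons, List.take_zero, List.cons_append] at hc
  have hne : (a :: b :: (l ++ [a])) ≠ [] := by simp
  have hlast : (a :: b :: (l ++ [a])).getLast hne = a := by simp
  obtain ⟨w, hw⟩ : ∃ w : G.Walk a a, w.support = a :: b :: (l ++ [a]) :=
    ⟨(SimpleGraph.Walk.ofSupport _ hne hc).copy List.head_cons hlast, by
      rw [SimpleGraph.Walk.support_copy, SimpleGraph.Walk.support_ofSupport]⟩
  have hwl : w.length = l.length + 2 := by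
    have := w.length_support
    rw [hw] at this
    simp at this
    omega
  refine ⟨a, w, ?_, ?_, ?_⟩
  · rw [SimpleGraph.Walk.isCycle_iff_isPath_tail_and_le_length]
    constructor
    · rw [SimpleGraph.Walk.isPath_def, SimpleGraph.Walk.support_tail_of_not_nil, hw, List.tail_cons]
      · have : (b :: (l ++ [a])) = (b :: l) ++ [a] := by simp
        rw [this, List.nodup_append_comm]
        simpa using hnd
      · rw [← SimpleGraph.Walk.length_eq_zero_iff]
        omega
    · simp at hl; omega
  · simp [hwl]
  · intro x
    rw [hw]
    simp; tauto

theorem exists_perm_map_eq {α β : Type} (f : α → β) {l m : List β} (h : l.Perm m) :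
    ∀ {a : List α}, a.map f = l → ∃ a' : List α, a.Perm a' ∧ a'.map f = m := by
  induction h with
  | nil => intro a ha; exact ⟨a, .refl _, ha⟩
  | cons x _ ih =>
    intro a ha
    obtain ⟨y, b, rfl, rfl, hb⟩ := List.map_eq_cons_iff.1 ha
    obtain ⟨b', h1, h2⟩ := ih hb
    exact ⟨y :: b', h1.cons _, by simp [h2]⟩
  | swap x y l =>
    intro a ha
    obtain ⟨y', b, rfl, rfl, hb⟩ := List.map_eq_cons_iff.1 ha
    obtain ⟨x', b', rfl, rfl, hb'⟩ := List.map_eq_cons_iff.1 hb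
    exact ⟨x' :: y' :: b', .swap _ _ _, by simp [hb']⟩
  | trans _ _ ih1 ih2 =>
    intro a ha
    obtain ⟨b, h1, h2⟩ := ih1 ha
    obtain ⟨b', h3, h4⟩ := ih2 h2
    exact ⟨b', h1.trans h3, h4⟩

/-- A list of disjoint closed chains with the right lengths is a 2-factor. -/
theorem exists_two_factor_of_lists {t : ℕ} {ℓ : Fin t → ℕ} (h3 : ∀ i, 3 ≤ ℓ i)
    (hsum : ∑ i, ℓ i = Fintype.card V) {cs : List (List V)}
    (hlen : cs.map List.length = List.ofFn ℓ) (hnd : cs.flatten.Nodup)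
    (hch : ∀ c ∈ cs, (c ++ c.take 1).IsChain G.Adj) :
    ∃ (v : Fin t → V) (c : ∀ i, G.Walk (v i) (v i)),
      (∀ i, (c i).IsCycle ∧ (c i).length = ℓ i) ∧
      (∀ i j, i ≠ j → Disjoint (c i).support.toFinset (c j).support.toFinset) ∧
      Finset.univ.biUnion (fun i => (c i).support.toFinset) = Finset.univ := by
  have hct : cs.length = t := by simpa using congrArg List.length hlen
  subst hct
  have hli : ∀ i : Fin cs.length, cs[i].length = ℓ i := by
    intro i
    have h1 : (cs.map List.length)[(i : ℕ)]? = (List.ofFn ℓ)[(i : ℕ)]? := by rw [hlen]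
    simpa using h1
  rw [List.nodup_flatten] at hnd
  have hex : ∀ i : Fin cs.length, ∃ (v : V) (w : G.Walk v v), w.IsCycle ∧
      w.length = cs[i].length ∧ ∀ x, x ∈ w.support ↔ x ∈ cs[i] := fun i =>
    exists_cycle_of_isChain (by rw [hli i]; exact h3 i) (hnd.1 _ (List.getElem_mem _))
      (hch _ (List.getElem_mem _))
  choose v c hc1 hc2 hc3 using hex
  have hdis : ∀ i j, i ≠ j → Disjoint (c i).support.toFinset (c j).support.toFinset := by
    have aux : ∀ i j : Fin cs.length, i < j →
        Disjoint (c i).support.toFinset (c j).support.toFinset := by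
      intro i j hij
      have := List.pairwise_iff_getElem.1 hnd.2 i j i.2 j.2 hij
      rw [disjoint_left]
      intro x hx hx'
      rw [List.mem_toFinset, hc3] at hx hx'
      exact this hx hx'
    intro i j hij
    rcases lt_or_gt_of_ne hij with h | h
    · exact aux i j h
    · exact (aux j i h).symm
  refine ⟨v, c, fun i => ⟨hc1 i, (hc2 i).trans (hli i)⟩, hdis, ?_⟩
  rw [← card_eq_iff_eq_univ, card_biUnion fun i _ j _ hij => hdis i j hij, ← hsum]
  refine sum_congr rfl fun i _ => ?_
  have : (c i).support.toFinset = cs[i].toFinset := by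
    ext x; simp [hc3]
  rw [this, ← hli i]
  exact List.toFinset_card_of_nodup (hnd.1 _ (List.getElem_mem _))

/-- A gadget `(a, b, x)` is hit by `v` if `v` is adjacent to `a` and `b`. -/
def Hits (G : SimpleGraph V) (v : V) (e : V × V × V) : Prop :=
  G.Adj v e.1 ∧ G.Adj v e.2.1

/-- Adjacency in template cycles, where the gadgets in `H` play the role of vertices that are
adjacent to both ends of the gadget. -/
def TemplateAdj (G : SimpleGraph V) (H : Finset (V × V × V)) : V ⊕ (V × V × V) →
    V ⊕ (V × V × V) → Prop
  | .inl x, .inl y => G.Adj x y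
  | .inl x, .inr e => e ∈ H ∧ (x = e.1 ∨ x = e.2.1)
  | .inr e, .inl x => e ∈ H ∧ (x = e.1 ∨ x = e.2.1)
  | .inr _, .inr _ => False

theorem TemplateAdj.fill {H : Finset (V × V × V)} {f : V × V × V → V}
    (hf : ∀ e ∈ H, Hits G (f e) e) {s t : V ⊕ (V × V × V)} (h : TemplateAdj G H s t) :
    G.Adj (Sum.elim id f s) (Sum.elim id f t) := by
  rcases s with x | e <;> rcases t with y | e'
  · exact h
  · obtain ⟨h1, rfl | rfl⟩ := h
    · exact (hf _ h1).1.symm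
    · exact (hf _ h1).2.symm
  · obtain ⟨h1, rfl | rfl⟩ := h
    · exact (hf _ h1).1
    · exact (hf _ h1).2
  · exact h.elim

/-- Template cycles that use each remaining gadget once and cover the exceptional set can be
completed to a 2-factor. -/
theorem exists_two_factor_of_template {b y : ℕ} (hG : Expands G b y) {t : ℕ} {ℓ : Fin t → ℕ}
    (h3 : ∀ i, 3 ≤ ℓ i) (hsum : ∑ i, ℓ i = Fintype.card V) {H : Finset (V × V × V)}
    {S U₀ : Finset V}
    (hflex : ∀ U : Finset V, U₀ \ S ⊆ U → Disjoint U S → U.card = H.card →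
      ∃ f : V × V × V → V, (∀ e ∈ H, f e ∈ U ∧ Hits G (f e) e) ∧
        Set.InjOn f (H : Finset (V × V × V)))
    (hslack : U₀.card + y + b ≤ H.card)
    {cs : List (List (V ⊕ (V × V × V)))} {rest : List ℕ}
    (hch : ∀ c ∈ cs, (c ++ c.take 1).IsChain (TemplateAdj G H)) (hnd : cs.flatten.Nodup)
    (hH : ∀ e, .inr e ∈ cs.flatten ↔ e ∈ H) (hS : ∀ v ∈ S, .inl v ∈ cs.flatten)
    (hU₀ : ∀ v ∈ U₀ \ S, .inl v ∉ cs.flatten)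
    (hperm : (cs.map List.length ++ rest).Perm (List.ofFn ℓ)) :
    ∃ (v : Fin t → V) (c : ∀ i, G.Walk (v i) (v i)),
      (∀ i, (c i).IsCycle ∧ (c i).length = ℓ i) ∧
      (∀ i j, i ≠ j → Disjoint (c i).support.toFinset (c j).support.toFinset) ∧
      Finset.univ.biUnion (fun i => (c i).support.toFinset) = Finset.univ := by
  classical
  have hrest : ∀ x ∈ rest, 3 ≤ x := by
    intro x hx
    have := hperm.subset (List.mem_append_right _ hx)
    obtain ⟨i, rfl⟩ := (List.mem_ofFn' _ _).1 this
    exact h3 i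
  let A : Finset V := univ.filter fun v => Sum.inl v ∈ cs.flatten
  have hmemA : ∀ v, v ∈ A ↔ Sum.inl v ∈ cs.flatten := by simp [A]
  have hAH : cs.flatten.toFinset = A.disjSum H := by
    ext s
    rcases s with v | e
    · rw [List.mem_toFinset, inl_mem_disjSum, hmemA]
    · rw [List.mem_toFinset, inr_mem_disjSum, hH]
  have hlenAH : (cs.map List.length).sum = A.card + H.card := by
    rw [← List.length_flatten, ← List.toFinset_card_of_nodup hnd, hAH, card_disjSum]
  have htot : (cs.map List.length).sum + rest.sum = Fintype.card V := by
    rw [← List.sum_append, hperm.sum_eq, List.sum_ofFn, hsum]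
  have hAU : Disjoint A (U₀ \ S) :=
    disjoint_right.2 fun v hv hvA => hU₀ v hv ((hmemA v).1 hvA)
  have hU₀c : (U₀ \ S).card ≤ U₀.card := card_le_card sdiff_subset
  have hPc : (univ \ (A ∪ (U₀ \ S)) : Finset V).card + A.card + (U₀ \ S).card =
      Fintype.card V := by
    rw [add_assoc, ← card_union_of_disjoint hAU, card_sdiff_add_card_eq_card (subset_univ _)]
    rfl
  obtain ⟨ds, hd1, hd2, hd3, hd4⟩ := hG.exists_cycles rest hrest (univ \ (A ∪ (U₀ \ S)))
    (by omega)
  have hBc : ds.flatten.toFinset.card = rest.sum := by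
    rw [List.toFinset_card_of_nodup hd2, List.length_flatten, hd1]
  have hAB : Disjoint A ds.flatten.toFinset := disjoint_right.2 fun v hv hvA => by
    have := hd3 v (List.mem_toFinset.1 hv)
    exact (mem_sdiff.1 this).2 (mem_union_left _ hvA)
  have hUc : (univ \ (A ∪ ds.flatten.toFinset) : Finset V).card = H.card := by
    have h1 : (univ \ (A ∪ ds.flatten.toFinset) : Finset V).card +
        (A ∪ ds.flatten.toFinset).card = Fintype.card V :=
      card_sdiff_add_card_eq_card (subset_univ _)
    rw [card_union_of_disjoint hAB] at h1
    omega
  obtain ⟨f, hf1, hf2⟩ := hflex (univ \ (A ∪ ds.flatten.toFinset))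
    (by
      intro v hv
      simp only [mem_sdiff, mem_univ, true_and, mem_union, not_or]
      refine ⟨fun h => disjoint_left.1 hAU h hv, fun h => ?_⟩
      have := hd3 v (List.mem_toFinset.1 h)
      exact (mem_sdiff.1 this).2 (mem_union_right _ hv))
    (disjoint_left.2 fun v hv hvS =>
      (mem_sdiff.1 hv).2 (mem_union_left _ ((hmemA v).2 (hS v hvS)))) hUc
  let φ : V ⊕ (V × V × V) → V := Sum.elim id f
  have hφ : ∀ s ∈ cs.flatten, φ s ∉ ds.flatten := by
    intro s hs hs'
    rcases s with v | e
    · exact disjoint_left.1 hAB ((hmemA v).2 hs) (List.mem_toFinset.2 hs')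
    · have := (hf1 e ((hH e).1 hs)).1
      exact (mem_sdiff.1 this).2 (mem_union_right _ (List.mem_toFinset.2 hs'))
  have hinj : ∀ s ∈ cs.flatten, ∀ s' ∈ cs.flatten, φ s = φ s' → s = s' := by
    have hcross : ∀ v e, Sum.inl v ∈ cs.flatten → Sum.inr e ∈ cs.flatten → v ≠ f e := by
      rintro v e hv he rfl
      exact (mem_sdiff.1 (hf1 e ((hH e).1 he)).1).2 (mem_union_left _ ((hmemA _).2 hv))
    intro s hs s' hs' h
    rcases s with v | e <;> rcases s' with v' | e'
    · exact congrArg _ h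
    · exact (hcross v e' hs hs' h).elim
    · exact (hcross v' e hs' hs h.symm).elim
    · exact congrArg _ (hf2 ((hH e).1 hs) ((hH e').1 hs') h)
  let es : List (List V) := cs.map (List.map φ) ++ ds
  have hes : es.map List.length = cs.map List.length ++ rest := by
    simp [es, hd1, Function.comp_def]
  have hesnd : es.flatten.Nodup := by
    simp only [es, List.flatten_append, ← List.map_flatten]
    rw [List.nodup_append]
    refine ⟨List.Nodup.map_on hinj hnd, hd2, ?_⟩
    intro x hx z hz hxz
    obtain ⟨s, hs, rfl⟩ := List.mem_map.1 hx
    exact hφ s hs (hxz ▸ hz)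
  have hesch : ∀ c ∈ es, (c ++ c.take 1).IsChain G.Adj := by
    intro c hc
    rcases List.mem_append.1 hc with hc | hc
    · obtain ⟨d, hd, rfl⟩ := List.mem_map.1 hc
      rw [← List.map_take, ← List.map_append, List.isChain_map]
      exact (hch d hd).imp fun s s' h => h.fill fun e he => (hf1 e he).2
    · exact hd4 c hc
  obtain ⟨fs, hp, hfs⟩ := exists_perm_map_eq List.length hperm hes
  exact exists_two_factor_of_lists h3 hsum hfs ((hp.flatten).nodup_iff.1 hesnd)
    fun c hc => hesch c (hp.mem_iff.2 hc)

end assembly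

section pseudorandom

variable {V : Type} [Fintype V] [DecidableEq V] {G : SimpleGraph V} [DecidableRel G.Adj]
  {p lam ε : ℝ}

/-- The standing quantitative assumptions extracted from bijumbledness. -/
structure Pseudorandom (G : SimpleGraph V) [DecidableRel G.Adj] (p lam ε : ℝ) : Prop where
  bij : Bijumbled G p lam
  p_pos : 0 < p
  p_le : p ≤ 1
  ε_pos : 0 < ε
  lam_pos : 0 < lam
  lam_le : lam ≤ ε * p ^ 2 * Fintype.card V
  big : 100 ≤ ε * p * Fintype.card V

namespace Pseudorandom

variable (h : Pseudorandom G p lam ε)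
include h

theorem card_pos : (0 : ℝ) < Fintype.card V := by
  by_contra! hn
  have := h.big
  have := mul_nonneg h.ε_pos.le h.p_pos.le
  nlinarith

theorem lam_sq_le : lam ^ 2 ≤ ε ^ 2 * p ^ 4 * (Fintype.card V : ℝ) ^ 2 := by
  calc lam ^ 2 ≤ (ε * p ^ 2 * Fintype.card V) ^ 2 := pow_le_pow_left₀ h.lam_pos.le h.lam_le 2
    _ = _ := by ring

theorem low {X Y : Finset V} (hX : ∀ x ∈ X, ((nb G x Y).card : ℝ) ≤ p * Y.card / 2) :
    (X.card : ℝ) * Y.card ≤ 4 * ε ^ 2 * p ^ 2 * (Fintype.card V : ℝ) ^ 2 := by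
  have h1 := card_mul_card_le_of_low_degree h.bij h.p_pos hX
  have h2 := h.lam_sq_le
  have hp : 0 < p ^ 2 := pow_pos h.p_pos 2
  refine le_of_mul_le_mul_left ?_ hp
  nlinarith

theorem expands : Expands G ⌈3 * (ε * p * Fintype.card V)⌉₊ ⌈16 * (ε * Fintype.card V)⌉₊ := by
  set n : ℝ := (Fintype.card V : ℝ) with hn
  have hn0 : 0 < n := h.card_pos
  have hbig := h.big
  have hp := h.p_pos
  have hε := h.ε_pos
  have hb := Nat.le_ceil (3 * (ε * p * n))
  have hb' := (Nat.ceil_lt_add_one (a := 3 * (ε * p * n)) (by positivity)).le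
  have hy := Nat.le_ceil (16 * (ε * n))
  set b := ⌈3 * (ε * p * n)⌉₊
  set y := ⌈16 * (ε * n)⌉₊
  have hq : 0 < ε * p * n := by positivity
  constructor
  · intro A B hA hB
    by_contra! hcon
    have h1 := h.low (X := A) (Y := B) (fun x hx => by
      have : nb G x B = ∅ := by
        rw [eq_empty_iff_forall_notMem]
        intro v hv
        rw [mem_nb] at hv
        exact hcon x hx v hv.1 hv.2
      rw [this]; simp; positivity)
    have hA' : 3 * (ε * p * n) ≤ A.card := hb.trans (by exact_mod_cast hA)
    have hB' : 3 * (ε * p * n) ≤ B.card := hb.trans (by exact_mod_cast hB)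
    have : 3 * (ε * p * n) * (3 * (ε * p * n)) ≤ A.card * B.card := by gcongr
    nlinarith
  · intro A Y hA hY
    by_contra! hcon
    have hA' : 3 * (ε * p * n) ≤ A.card := hb.trans (by exact_mod_cast hA)
    have hY' : 16 * (ε * n) ≤ Y.card := hy.trans (by exact_mod_cast hY)
    have h1 := h.low (X := A) (Y := Y) (fun x hx => by
      have h2 : ((nb G x Y).card : ℝ) ≤ 2 * b := by exact_mod_cast (hcon x hx).le
      have h3 : p * (16 * (ε * n)) ≤ p * Y.card := by gcongr
      nlinarith)
    have : 3 * (ε * p * n) * (16 * (ε * n)) ≤ A.card * Y.card := by gcongr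
    have hp2 : p ^ 2 ≤ p := by nlinarith [h.p_le]
    have : 4 * ε ^ 2 * n ^ 2 * p ^ 2 ≤ 4 * ε ^ 2 * n ^ 2 * p := by gcongr
    have : 0 < ε ^ 2 * n ^ 2 * p := by positivity
    nlinarith

/-- Number of `b` that have no neighbour in the neighbourhood of `a` within `X`. -/
theorem card_no_common_le {a : V} {X : Finset V} {η : ℝ}
    (hX : η ≤ X.card) (ha : p * X.card / 2 < (nb G a X).card) :
    ((univ.filter fun b => ∀ v ∈ X, ¬ (G.Adj v a ∧ G.Adj v b)).card : ℝ) * η ≤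
      8 * ε ^ 2 * p * (Fintype.card V : ℝ) ^ 2 := by
  set B := univ.filter fun b => ∀ v ∈ X, ¬ (G.Adj v a ∧ G.Adj v b) with hB
  have h1 := h.low (X := B) (Y := nb G a X) (fun x hx => by
    have : nb G x (nb G a X) = ∅ := by
      rw [eq_empty_iff_forall_notMem]
      intro v hv
      simp only [mem_nb] at hv
      exact (mem_filter.1 hx).2 v hv.1.1 ⟨hv.1.2.symm, hv.2.symm⟩
    rw [this]; have := h.p_pos; simp; positivity)
  have h2 : p * η / 2 ≤ (nb G a X).card := by
    have : p * η ≤ p * X.card := by have := h.p_pos; gcongr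
    linarith
  have h3 : (B.card : ℝ) * (p * η / 2) ≤ B.card * (nb G a X).card := by gcongr
  have hp := h.p_pos
  refine le_of_mul_le_mul_left ?_ hp
  nlinarith

/-- Few pairs have no common neighbour in `X`. -/
theorem card_pairs_missing_le {X : Finset V} {η : ℝ} (hη : 0 < η)
    (hX : η * p * Fintype.card V ≤ X.card) :
    ((univ.filter fun ab : V × V => ∀ v ∈ X, ¬ (G.Adj v ab.1 ∧ G.Adj v ab.2)).card : ℝ) * η ≤
      12 * ε ^ 2 * (Fintype.card V : ℝ) ^ 2 := by
  have hn0 : (0 : ℝ) < Fintype.card V := h.card_pos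
  have hp := h.p_pos
  have hp1 := h.p_le
  have hsum : (univ.filter fun ab : V × V => ∀ v ∈ X, ¬ (G.Adj v ab.1 ∧ G.Adj v ab.2)).card =
      ∑ a : V, (univ.filter fun b => ∀ v ∈ X, ¬ (G.Adj v a ∧ G.Adj v b)).card := by
    simp only [card_filter]
    rw [← univ_product_univ, sum_product]
  set Lo : Finset V := univ.filter fun a => ((nb G a X).card : ℝ) ≤ p * X.card / 2 with hLo
  have hlo := h.low (X := Lo) (Y := X) (fun x hx => (mem_filter.1 hx).2)
  set n : ℝ := (Fintype.card V : ℝ) with hn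
  have hLoc : (Lo.card : ℝ) * η ≤ 4 * ε ^ 2 * n := by
    have h1 : (Lo.card : ℝ) * (η * p * n) ≤ Lo.card * X.card := by gcongr
    have h2 : 4 * ε ^ 2 * n ^ 2 * p ^ 2 ≤ 4 * ε ^ 2 * n ^ 2 * p := by
      gcongr; nlinarith
    refine le_of_mul_le_mul_right ?_ (by positivity : 0 < p * n)
    nlinarith
  have hterm : ∀ a : V, ((univ.filter fun b => ∀ v ∈ X, ¬ (G.Adj v a ∧ G.Adj v b)).card : ℝ) * η ≤
      (if a ∈ Lo then n * η else 0) + 8 * ε ^ 2 * n := by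
    intro a
    split_ifs with ha
    · have : ((univ.filter fun b => ∀ v ∈ X, ¬ (G.Adj v a ∧ G.Adj v b)).card : ℝ) ≤ n := by
        rw [hn]; exact_mod_cast card_le_univ _
      have : 0 < 8 * ε ^ 2 * n := by have := h.ε_pos; positivity
      nlinarith
    · have h1 := h.card_no_common_le (a := a) (X := X) (η := η * p * n) hX (by
        simpa [hLo] using ha)
      rw [zero_add]
      refine le_of_mul_le_mul_right ?_ (by positivity : 0 < p * n)
      rw [← hn] at h1
      nlinarith
  rw [hsum]
  push_cast
  rw [sum_mul]
  refine (sum_le_sum fun a _ => hterm a).trans ?_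
  rw [sum_add_distrib, ← sum_filter, filter_mem_eq_inter, univ_inter, sum_const, sum_const,
    card_univ, nsmul_eq_mul, nsmul_eq_mul, ← hn]
  nlinarith

/-- Few edges have no common neighbour in `X`. -/
theorem card_edges_missing_le {X : Finset V} {η : ℝ} (hη : 0 < η) (hη1 : η ≤ 1)
    (hX : η * Fintype.card V ≤ X.card) :
    ((univ.filter fun ab : V × V => G.Adj ab.1 ab.2 ∧
      ∀ v ∈ X, ¬ (G.Adj v ab.1 ∧ G.Adj v ab.2)).card : ℝ) * η ≤
      14 * ε ^ 2 * p * (Fintype.card V : ℝ) ^ 2 := by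
  have hn0 : (0 : ℝ) < Fintype.card V := h.card_pos
  have hp := h.p_pos
  have hp1 := h.p_le
  have hε := h.ε_pos
  have hlam := h.lam_le
  have hsum : (univ.filter fun ab : V × V => G.Adj ab.1 ab.2 ∧
      ∀ v ∈ X, ¬ (G.Adj v ab.1 ∧ G.Adj v ab.2)).card =
      ∑ a : V, (univ.filter fun b => G.Adj a b ∧ ∀ v ∈ X, ¬ (G.Adj v a ∧ G.Adj v b)).card := by
    simp only [card_filter]
    rw [← univ_product_univ, sum_product]
  set Lo : Finset V := univ.filter fun a => ((nb G a X).card : ℝ) ≤ p * X.card / 2 with hLo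
  have hlo := h.low (X := Lo) (Y := X) (fun x hx => (mem_filter.1 hx).2)
  set n : ℝ := (Fintype.card V : ℝ) with hn
  have hLoc : (Lo.card : ℝ) * η ≤ 4 * ε ^ 2 * p ^ 2 * n := by
    have h1 : (Lo.card : ℝ) * (η * n) ≤ Lo.card * X.card := by gcongr
    refine le_of_mul_le_mul_right ?_ hn0
    nlinarith
  have hLoe : (∑ a ∈ Lo, ((nb G a univ).card : ℝ)) * η ≤ 6 * ε ^ 2 * p * n ^ 2 := by
    rcases Lo.eq_empty_or_nonempty with h0 | h0
    · rw [h0]; simp; positivity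
    have h1 := (abs_lt.1 (h.bij Lo univ h0 (h0.mono (subset_univ _)))).2
    rw [ePairs_eq_sum, card_univ, ← hn] at h1
    push_cast at h1
    have h2 : Real.sqrt (Lo.card * n) ≤ 2 * ε * p * n / η := by
      rw [Real.sqrt_le_left (by positivity), div_pow, le_div_iff₀ (by positivity)]
      have : Lo.card * n * η ^ 2 ≤ Lo.card * n * η := by
        gcongr; nlinarith
      nlinarith
    have h3 : lam * Real.sqrt (Lo.card * n) ≤ ε * p ^ 2 * n * (2 * ε * p * n / η) := by
      gcongr
    have h4 : lam * Real.sqrt (Lo.card * n) * η ≤ 2 * ε ^ 2 * p ^ 3 * n ^ 2 := by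
      calc _ ≤ ε * p ^ 2 * n * (2 * ε * p * n / η) * η := by gcongr
        _ = _ := by field_simp
    have h5 : p * Lo.card * n * η ≤ 4 * ε ^ 2 * p ^ 3 * n ^ 2 := by
      calc _ = p * n * (Lo.card * η) := by ring
        _ ≤ p * n * (4 * ε ^ 2 * p ^ 2 * n) := by gcongr
        _ = _ := by ring
    have h6 : p ^ 3 ≤ p := by
      calc p ^ 3 ≤ p ^ 1 := pow_le_pow_of_le_one hp.le hp1 (by norm_num)
        _ = p := pow_one p
    have h7 : ε ^ 2 * n ^ 2 * p ^ 3 ≤ ε ^ 2 * n ^ 2 * p := by gcongr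
    nlinarith
  have hterm : ∀ a : V,
      ((univ.filter fun b => G.Adj a b ∧ ∀ v ∈ X, ¬ (G.Adj v a ∧ G.Adj v b)).card : ℝ) * η ≤
      (if a ∈ Lo then ((nb G a univ).card : ℝ) * η else 0) + 8 * ε ^ 2 * p * n := by
    intro a
    split_ifs with ha
    · have : (univ.filter fun b => G.Adj a b ∧ ∀ v ∈ X, ¬ (G.Adj v a ∧ G.Adj v b)).card ≤
          (nb G a univ).card := card_le_card fun v hv => by
        simp only [mem_filter, mem_nb] at hv ⊢; tauto
      have : ((univ.filter fun b => G.Adj a b ∧ ∀ v ∈ X, ¬ (G.Adj v a ∧ G.Adj v b)).card : ℝ) ≤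
          (nb G a univ).card := by exact_mod_cast this
      have : 0 < 8 * ε ^ 2 * p * n := by positivity
      nlinarith
    · have h1 := h.card_no_common_le (a := a) (X := X) (η := η * n) hX (by
        simpa [hLo] using ha)
      have : (univ.filter fun b => G.Adj a b ∧ ∀ v ∈ X, ¬ (G.Adj v a ∧ G.Adj v b)).card ≤
          (univ.filter fun b => ∀ v ∈ X, ¬ (G.Adj v a ∧ G.Adj v b)).card :=
        card_le_card fun v hv => by
          simp only [mem_filter] at hv ⊢; tauto
      have h2 : ((univ.filter fun b => G.Adj a b ∧ ∀ v ∈ X, ¬ (G.Adj v a ∧ G.Adj v b)).card : ℝ) ≤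
          (univ.filter fun b => ∀ v ∈ X, ¬ (G.Adj v a ∧ G.Adj v b)).card := by exact_mod_cast this
      rw [zero_add]
      refine le_of_mul_le_mul_right ?_ hn0
      rw [← hn] at h1
      have h3 := mul_le_mul_of_nonneg_right h2 (by positivity : 0 ≤ η * n)
      nlinarith
  rw [hsum]
  push_cast
  rw [sum_mul]
  refine (sum_le_sum fun a _ => hterm a).trans ?_
  rw [sum_add_distrib, ← sum_filter, filter_mem_eq_inter, univ_inter, sum_const,
    card_univ, nsmul_eq_mul, ← hn, ← sum_mul]
  nlinarith

end Pseudorandom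

end pseudorandom

section gadgets

variable {V : Type} [Fintype V] [DecidableEq V] {G : SimpleGraph V} [DecidableRel G.Adj]
  {p lam ε : ℝ}

/-- The vertices of a gadget. -/
def verts (e : V × V × V) : Finset V := {e.1, e.2.1, e.2.2}

theorem mem_verts {e : V × V × V} {v : V} : v ∈ verts e ↔ v = e.1 ∨ v = e.2.1 ∨ v = e.2.2 := by
  simp [verts]

instance (G : SimpleGraph V) [DecidableRel G.Adj] (v : V) (e : V × V × V) :
    Decidable (Hits G v e) :=
  inferInstanceAs (Decidable (G.Adj v e.1 ∧ G.Adj v e.2.1))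

theorem exists_gadgets (G : SimpleGraph V) [DecidableRel G.Adj] (Good : V × V × V → Prop) (W₀ : Finset V) (m K s : ℕ)
    (hstep : ∀ W ⊆ W₀, W₀.card ≤ W.card + 3 * m → ∃ PP : Finset (V × V × V), PP.Nonempty ∧
      (∀ e ∈ PP, Good e ∧ verts e ⊆ W) ∧ ∀ X : Finset V, s ≤ X.card →
        (PP.filter fun e => ∀ v ∈ X, ¬ Hits G v e).card * 2 ^ K ≤ PP.card) :
    ∃ M : Finset (V × V × V), M.card = m ∧ (∀ e ∈ M, Good e ∧ verts e ⊆ W₀) ∧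
      (∀ e ∈ M, ∀ e' ∈ M, e ≠ e' → Disjoint (verts e) (verts e')) ∧
      ∀ X : Finset V, s ≤ X.card →
        K * (M.filter fun e => ∀ v ∈ X, ¬ Hits G v e).card ≤ Fintype.card V + m := by
  obtain ⟨M, ⟨h1, h2⟩, h3, h4⟩ := exists_card_eq_of_potential
    (fun M : Finset (V × V × V) => (∀ e ∈ M, Good e ∧ verts e ⊆ W₀) ∧
      ∀ e ∈ M, ∀ e' ∈ M, e ≠ e' → Disjoint (verts e) (verts e'))
    (univ.filter fun X : Finset V => s ≤ X.card) (fun X e => ∀ v ∈ X, ¬ Hits G v e) K m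
    (by simp) (by
      rintro M ⟨hM1, hM2⟩ hm
      have hused : (M.biUnion verts).card ≤ 3 * m := by
        have : (M.biUnion verts).card ≤ M.card * 3 := card_biUnion_le_card_mul _ _ _
          fun e _ => card_le_three
        omega
      obtain ⟨PP, hP1, hP2, hP3⟩ := hstep (W₀ \ M.biUnion verts) sdiff_subset (by
        have := le_card_sdiff (M.biUnion verts) W₀
        omega)
      refine ⟨PP, hP1, fun e he => ?_, fun X hX => hP3 X (mem_filter.1 hX).2⟩
      obtain ⟨hg, hv⟩ := hP2 e he
      have hdis : ∀ e' ∈ M, Disjoint (verts e) (verts e') := fun e' he' =>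
        disjoint_left.2 fun v hve hve' =>
          (mem_sdiff.1 (hv hve)).2 (mem_biUnion.2 ⟨e', he', hve'⟩)
      refine ⟨fun heM => ?_, fun e' he' => ?_, fun e' he' e'' he'' hne => ?_⟩
      · exact disjoint_left.1 (hdis e heM) (mem_verts.2 (Or.inl rfl)) (mem_verts.2 (Or.inl rfl))
      · rcases mem_insert.1 he' with rfl | he'
        · exact ⟨hg, hv.trans sdiff_subset⟩
        · exact hM1 e' he'
      · rcases mem_insert.1 he' with h | h <;> rcases mem_insert.1 he'' with h' | h'
        · exact (hne (h.trans h'.symm)).elim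
        · rw [h]; exact hdis _ h'
        · rw [h']; exact (hdis _ h).symm
        · exact hM2 _ h _ h' hne)
  refine ⟨M, h3, h1, h2, fun X hX => ?_⟩
  have h5 := h4 X (by simpa using hX)
  have h6 : (univ.filter fun X : Finset V => s ≤ X.card).card ≤ 2 ^ Fintype.card V := by
    refine (card_le_univ _).trans ?_
    rw [Fintype.card_finset]
  refine (Nat.pow_le_pow_iff_right (a := 2) (by norm_num)).1 ?_
  rw [pow_add]
  exact h5.trans (Nat.mul_le_mul_right _ h6)

namespace Pseudorandom

variable (h : Pseudorandom G p lam ε)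
include h

theorem exists_edge_gadgets {η : ℝ} (hη : 0 < η) (hη1 : η ≤ 1) {W₀ : Finset V} {m K s : ℕ}
    (hs : η * Fintype.card V ≤ s) (hε : ε ≤ 1 / 1000) (hK : 5600 * ε ^ 2 * 2 ^ K ≤ η)
    (hW₀ : (Fintype.card V : ℝ) / 10 + 3 * m ≤ W₀.card) :
    ∃ M : Finset (V × V × V), M.card = m ∧
      (∀ e ∈ M, (G.Adj e.1 e.2.1 ∧ G.Adj e.2.2 e.1 ∧ G.Adj e.2.2 e.2.1) ∧ verts e ⊆ W₀) ∧
      (∀ e ∈ M, ∀ e' ∈ M, e ≠ e' → Disjoint (verts e) (verts e')) ∧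
      ∀ X : Finset V, s ≤ X.card →
        K * (M.filter fun e => ∀ v ∈ X, ¬ Hits G v e).card ≤ Fintype.card V + m := by
  refine exists_gadgets G (fun e => G.Adj e.1 e.2.1 ∧ G.Adj e.2.2 e.1 ∧ G.Adj e.2.2 e.2.1)
    W₀ m K s fun W hW hWc => ?_
  have hn0 : (0 : ℝ) < Fintype.card V := h.card_pos
  have hp := h.p_pos
  have hp1 := h.p_le
  have hε0 := h.ε_pos
  have hlam := h.lam_le
  have hmiss := fun (X : Finset V) (η : ℝ) => h.card_edges_missing_le (X := X) (η := η)
  set n : ℝ := (Fintype.card V : ℝ) with hn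
  have hWn : n / 10 ≤ W.card := by
    have : (W₀.card : ℝ) ≤ W.card + 3 * m := by exact_mod_cast hWc
    linarith
  have hWne : W.Nonempty := by
    rw [← Finset.card_pos]
    have : (0 : ℝ) < W.card := by linarith
    exact_mod_cast this
  let AA := (W ×ˢ W).filter fun ab => G.Adj ab.1 ab.2
  have hAA : p * n ^ 2 / 200 ≤ (AA.card : ℝ) := by
    have h1 := (abs_lt.1 (h.bij W W hWne hWne)).1
    rw [Real.sqrt_mul_self (by positivity)] at h1
    have h2 : lam ≤ p * n / 20 := by
      refine hlam.trans ?_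
      have : ε * p * (p * n) ≤ 1 / 1000 * 1 * (p * n) := by gcongr
      nlinarith
    have h3 : (AA.card : ℝ) = (ePairs G W W : ℝ) := rfl
    have h4 : p * n / 20 ≤ p * W.card - lam := by nlinarith
    have h5 : n / 10 * (p * n / 20) ≤ W.card * (p * W.card - lam) := by gcongr
    nlinarith
  let Q := AA.filter fun ab => ∃ x ∈ W, G.Adj x ab.1 ∧ G.Adj x ab.2
  have hbad : ((AA.filter fun ab => ¬ ∃ x ∈ W, G.Adj x ab.1 ∧ G.Adj x ab.2).card : ℝ) ≤
      p * n ^ 2 / 400 := by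
    have h1 := hmiss W (1 / 10) (by norm_num) (by norm_num) (by linarith)
    have h2 : (AA.filter fun ab => ¬ ∃ x ∈ W, G.Adj x ab.1 ∧ G.Adj x ab.2).card ≤
      (univ.filter fun ab : V × V => G.Adj ab.1 ab.2 ∧
        ∀ v ∈ W, ¬ (G.Adj v ab.1 ∧ G.Adj v ab.2)).card := by
      refine card_le_card fun ab hab => ?_
      simp only [AA, mem_filter, not_exists, not_and, mem_univ, true_and] at hab ⊢
      exact ⟨hab.1.2, fun v hv h1 h2 => hab.2 v hv h1 h2⟩
    have h3 : ((AA.filter fun ab => ¬ ∃ x ∈ W, G.Adj x ab.1 ∧ G.Adj x ab.2).card : ℝ) ≤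
      (univ.filter fun ab : V × V => G.Adj ab.1 ab.2 ∧
        ∀ v ∈ W, ¬ (G.Adj v ab.1 ∧ G.Adj v ab.2)).card := by exact_mod_cast h2
    have h4 : ε ^ 2 ≤ (1 / 1000) ^ 2 := by gcongr
    have h5 : ε ^ 2 * (p * n ^ 2) ≤ (1 / 1000) ^ 2 * (p * n ^ 2) := by gcongr
    nlinarith
  have hQ : p * n ^ 2 / 400 ≤ (Q.card : ℝ) := by
    have h1 : Q.card + (AA.filter fun ab => ¬ ∃ x ∈ W, G.Adj x ab.1 ∧ G.Adj x ab.2).card =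
        AA.card := card_filter_add_card_filter_not _
    have h2 : (Q.card : ℝ) + (AA.filter fun ab =>
        ¬ ∃ x ∈ W, G.Adj x ab.1 ∧ G.Adj x ab.2).card = AA.card := by exact_mod_cast h1
    linarith
  have hex : ∀ ab : V × V, ∃ x, ab ∈ Q → x ∈ W ∧ G.Adj x ab.1 ∧ G.Adj x ab.2 := by
    intro ab
    by_cases hab : ab ∈ Q
    · obtain ⟨x, hx⟩ := (mem_filter.1 hab).2
      exact ⟨x, fun _ => hx⟩
    · exact ⟨ab.1, fun hh => (hab hh).elim⟩
  choose xf hxf using hex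
  let ι : V × V ↪ V × V × V := ⟨fun ab => (ab.1, ab.2, xf ab), fun ab ab' hh => by
    simp only [Prod.mk.injEq] at hh
    exact Prod.ext hh.1 hh.2.1⟩
  have hQpos : 0 < Q.card := by
    have : (0 : ℝ) < Q.card := lt_of_lt_of_le (by positivity) hQ
    exact_mod_cast this
  refine ⟨Q.map ι, (map_nonempty).2 (Finset.card_pos.1 hQpos), ?_, fun X hX => ?_⟩
  · intro e he
    obtain ⟨ab, hab, rfl⟩ := mem_map.1 he
    have h1 := hxf ab hab
    have h2 := mem_filter.1 (mem_filter.1 hab).1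
    have h3 := mem_product.1 h2.1
    refine ⟨⟨h2.2, h1.2⟩, fun v hv => ?_⟩
    rcases mem_verts.1 hv with rfl | rfl | rfl
    · exact h3.1
    · exact h3.2
    · exact h1.1
  · rw [filter_map, card_map, card_map]
    have hXη : η * n ≤ X.card := hs.trans (by exact_mod_cast hX)
    have h1 := hmiss X η hη hη1 hXη
    have h2 : (Q.filter ((fun e => ∀ v ∈ X, ¬ Hits G v e) ∘ ι)).card ≤
      (univ.filter fun ab : V × V => G.Adj ab.1 ab.2 ∧
        ∀ v ∈ X, ¬ (G.Adj v ab.1 ∧ G.Adj v ab.2)).card := by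
      refine card_le_card fun ab hab => ?_
      have h3 := mem_filter.1 hab
      exact mem_filter.2 ⟨mem_univ _, (mem_filter.1 (mem_filter.1 h3.1).1).2, h3.2⟩
    have h3 : ((Q.filter ((fun e => ∀ v ∈ X, ¬ Hits G v e) ∘ ι)).card : ℝ) ≤
      (univ.filter fun ab : V × V => G.Adj ab.1 ab.2 ∧
        ∀ v ∈ X, ¬ (G.Adj v ab.1 ∧ G.Adj v ab.2)).card := by exact_mod_cast h2
    set q : ℝ := ((Q.filter ((fun e => ∀ v ∈ X, ¬ Hits G v e) ∘ ι)).card : ℝ) with hq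
    have h4 : q * η ≤ 14 * ε ^ 2 * p * n ^ 2 := (mul_le_mul_of_nonneg_right h3 hη.le).trans h1
    have h5 : q * 2 ^ K ≤ Q.card := by
      refine le_trans ?_ hQ
      refine le_of_mul_le_mul_right ?_ hη
      calc q * 2 ^ K * η = q * η * 2 ^ K := by ring
        _ ≤ 14 * ε ^ 2 * p * n ^ 2 * 2 ^ K := by gcongr
        _ = (5600 * ε ^ 2 * 2 ^ K) * (p * n ^ 2 / 400) := by ring
        _ ≤ η * (p * n ^ 2 / 400) := by gcongr
        _ = _ := by ring
    rw [hq] at h5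
    exact_mod_cast h5

theorem exists_pair_gadgets {η : ℝ} (hη : 0 < η) {W₀ : Finset V} {m K s : ℕ}
    (hs : η * p * Fintype.card V ≤ s) (hε : ε ≤ 1 / 1000) (hK : 5600 * ε ^ 2 * 2 ^ K ≤ η)
    (hW₀ : (Fintype.card V : ℝ) / 10 + 3 * m ≤ W₀.card) :
    ∃ M : Finset (V × V × V), M.card = m ∧
      (∀ e ∈ M, (e.1 ≠ e.2.1 ∧ e.2.2 = e.1) ∧ verts e ⊆ W₀) ∧
      (∀ e ∈ M, ∀ e' ∈ M, e ≠ e' → Disjoint (verts e) (verts e')) ∧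
      ∀ X : Finset V, s ≤ X.card →
        K * (M.filter fun e => ∀ v ∈ X, ¬ Hits G v e).card ≤ Fintype.card V + m := by
  refine exists_gadgets G (fun e => e.1 ≠ e.2.1 ∧ e.2.2 = e.1)
    W₀ m K s fun W hW hWc => ?_
  have hn0 : (0 : ℝ) < Fintype.card V := h.card_pos
  have hp := h.p_pos
  have hp1 := h.p_le
  have hε0 := h.ε_pos
  have hbig := h.big
  have hmiss := fun (X : Finset V) (η : ℝ) => h.card_pairs_missing_le (X := X) (η := η)
  set n : ℝ := (Fintype.card V : ℝ) with hn
  have hn100 : 100 ≤ n := by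
    have : ε * p * n ≤ 1 / 1000 * 1 * n := by gcongr
    linarith
  have hWn : n / 10 ≤ W.card := by
    have : (W₀.card : ℝ) ≤ W.card + 3 * m := by exact_mod_cast hWc
    linarith
  let Q := W.offDiag
  have hQ : n ^ 2 / 200 ≤ (Q.card : ℝ) := by
    have h1 : Q.card + W.card = W.card * W.card := by
      have := W.offDiag_card
      have := Nat.le_mul_self W.card
      simp only [Q]
      omega
    have h2 : (Q.card : ℝ) + W.card = W.card * W.card := by exact_mod_cast h1
    nlinarith
  let ι : V × V ↪ V × V × V := ⟨fun ab => (ab.1, ab.2, ab.1), fun ab ab' hh => by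
    simp only [Prod.mk.injEq] at hh
    exact Prod.ext hh.1 hh.2.1⟩
  have hQpos : 0 < Q.card := by
    have : (0 : ℝ) < Q.card := lt_of_lt_of_le (by positivity) hQ
    exact_mod_cast this
  refine ⟨Q.map ι, (map_nonempty).2 (Finset.card_pos.1 hQpos), ?_, fun X hX => ?_⟩
  · intro e he
    obtain ⟨ab, hab, rfl⟩ := mem_map.1 he
    have h2 := mem_offDiag.1 hab
    refine ⟨⟨h2.2.2, rfl⟩, fun v hv => ?_⟩
    rcases mem_verts.1 hv with rfl | rfl | rfl
    · exact h2.1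
    · exact h2.2.1
    · exact h2.1
  · rw [filter_map, card_map, card_map]
    have hXη : η * p * n ≤ X.card := hs.trans (by exact_mod_cast hX)
    have h1 := hmiss X η hη hXη
    have h2 : (Q.filter ((fun e => ∀ v ∈ X, ¬ Hits G v e) ∘ ι)).card ≤
      (univ.filter fun ab : V × V => ∀ v ∈ X, ¬ (G.Adj v ab.1 ∧ G.Adj v ab.2)).card :=
      card_le_card fun ab hab => mem_filter.2 ⟨mem_univ _, (mem_filter.1 hab).2⟩
    have h3 : ((Q.filter ((fun e => ∀ v ∈ X, ¬ Hits G v e) ∘ ι)).card : ℝ) ≤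
      (univ.filter fun ab : V × V => ∀ v ∈ X, ¬ (G.Adj v ab.1 ∧ G.Adj v ab.2)).card := by
      exact_mod_cast h2
    set q : ℝ := ((Q.filter ((fun e => ∀ v ∈ X, ¬ Hits G v e) ∘ ι)).card : ℝ) with hq
    have h4 : q * η ≤ 12 * ε ^ 2 * n ^ 2 := (mul_le_mul_of_nonneg_right h3 hη.le).trans h1
    have h5 : q * 2 ^ K ≤ Q.card := by
      refine le_trans ?_ hQ
      refine le_of_mul_le_mul_right ?_ hη
      calc q * 2 ^ K * η = q * η * 2 ^ K := by ring
        _ ≤ 12 * ε ^ 2 * n ^ 2 * 2 ^ K := by gcongr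
        _ = (5600 * ε ^ 2 * 2 ^ K) * (12 / 5600 * n ^ 2) := by ring
        _ ≤ η * (12 / 5600 * n ^ 2) := by gcongr
        _ ≤ n ^ 2 / 200 * η := by nlinarith [mul_pos hη (pow_pos hn0 2)]
    rw [hq] at h5
    exact_mod_cast h5

end Pseudorandom

end gadgets

section reservoir

variable {V : Type} [Fintype V] [DecidableEq V] {G : SimpleGraph V} [DecidableRel G.Adj]

/-- Two disjoint vertex sets into which every vertex has many neighbours, together with a bound on
the number of vertices with many neighbours in a set of size at most `q`. -/
structure Reservoir (G : SimpleGraph V) [DecidableRel G.Adj] (b y D r q d : ℕ)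
    (Y₁ Y₂ : Finset V) : Prop where
  exp : Expands G b y
  few : ∀ X Q : Finset V, Q.card ≤ q → (∀ x ∈ X, D ≤ (nb G x Q).card) → X.card ≤ r
  disj : Disjoint Y₁ Y₂
  deg₁ : ∀ v, d ≤ (nb G v Y₁).card
  deg₂ : ∀ v, d ≤ (nb G v Y₂).card
  le_deg : 2 * D + 2 * b + 40 * r ≤ d
  size₁ : 2 * q + 16 * r + 8 + y + b ≤ Y₁.card
  size₂ : 2 * q + 16 * r + 8 + y + b ≤ Y₂.card

variable {b y D r q d : ℕ} {Y₁ Y₂ : Finset V}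

/-- Every vertex of `Z` is covered by closed links, all of the same length, based at
vertices of `Z`. -/
theorem Reservoir.exists_loops (hR : Reservoir G b y D r q d Y₁ Y₂) {Z S : Finset V}
    (hZS : Z ⊆ S) {k : ℕ} (hk : 2 ≤ k ∧ k ≤ 8) (hq : 9 * S.card + 8 * r ≤ q) :
    ∃ Z' ⊆ Z, ∃ c : V → List V, Linkage G Z' id id (fun _ => k) (Y₁ ∪ Y₂) c ∧
      (∀ z ∈ Z', ∀ v ∈ c z, v ∉ Z') ∧ ∀ z ∈ Z, z ∈ Z' ∨ ∃ z' ∈ Z', z ∈ c z' := by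
  have hdeg := hR.le_deg
  have hs₁ := hR.size₁
  have hs₂ := hR.size₂
  set A := Z.filter fun z => D ≤ (nb G z S).card with hA
  have hAr : A.card ≤ r := hR.few A S (by omega) fun x hx => (mem_filter.1 hx).2
  have hnbA : ∀ v, d ≤ (nb G v (Y₂ \ A)).card + r := fun v => by
    have h1 := card_nb_sdiff (G := G) v Y₂ A
    have h2 := card_le_card (nb_subset (G := G) v A)
    have h3 := hR.deg₂ v
    omega
  have hYA := le_card_sdiff A Y₂
  obtain ⟨c₀, hc₀⟩ := hR.exp.exists_linkage (u := id) (w := id) (k := fun _ => k) A (Y₂ \ A)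
    (fun _ _ => hk) (fun j _ => by have := hnbA j; simp only [id]; omega)
    (fun j _ => by have := hnbA j; simp only [id]; omega) (by omega)
  set R := A.biUnion fun j => (c₀ j).toFinset with hRdef
  have hRc : R.card ≤ 8 * r := (hc₀.card_used fun _ _ => hk.2).trans (by omega)
  have hc₀' : Linkage G A id id (fun _ => k) R c₀ :=
    ⟨fun j hj => ⟨(hc₀.link j hj).nodup, (hc₀.link j hj).length, fun x hx =>
      mem_biUnion.2 ⟨j, hj, List.mem_toFinset.2 hx⟩, (hc₀.link j hj).chain⟩, hc₀.disj⟩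
  have hRY : R ⊆ Y₂ \ A := fun v hv => by
    obtain ⟨j, hj, hv⟩ := mem_biUnion.1 hv
    exact (hc₀.link j hj).mem v (List.mem_toFinset.1 hv)
  set B := (Z \ A) \ R with hB
  have hBS : B.card ≤ S.card := card_le_card ((sdiff_subset.trans sdiff_subset).trans hZS)
  have hQ := card_union_le S R
  have hBD : ∀ v ∈ B, (nb G v S).card < D := fun v hv => by
    have h1 := mem_sdiff.1 (mem_sdiff.1 hv).1
    by_contra! h2
    exact h1.2 (mem_filter.2 ⟨h1.1, h2⟩)
  have hnbB : ∀ v ∈ B, d ≤ (nb G v (Y₂ \ (S ∪ R))).card + D + 8 * r := fun v hv => by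
    have h1 := card_nb_sdiff (G := G) v Y₂ (S ∪ R)
    have h2 : (nb G v (S ∪ R)).card ≤ (nb G v S).card + (nb G v R).card := by
      unfold nb; rw [filter_union]; exact card_union_le _ _
    have h3 := card_le_card (nb_subset (G := G) v R)
    have h4 := hBD v hv
    have h5 := hR.deg₂ v
    omega
  have hYB := le_card_sdiff (S ∪ R) Y₂
  obtain ⟨c₁, hc₁, -⟩ := hR.exp.exists_linkage_two_rounds (u := id) (w := id) (k := fun _ => k) B
    Y₁ (Y₂ \ (S ∪ R)) (S ∪ R) D r (fun _ _ => hk) Function.injective_id.injOn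
    Function.injective_id.injOn (fun X Q hQ' => hR.few X Q (by omega))
    (fun j _ => by have := hR.deg₁ j; simp only [id]; omega)
    (fun j _ => by have := hR.deg₁ j; simp only [id]; omega) (by omega)
    (fun j hj => by have := hnbB j hj; simp only [id]; omega)
    (fun j hj => by have := hnbB j hj; simp only [id]; omega) (by omega)
    (disjoint_of_subset_left sdiff_subset (disjoint_of_subset_right sdiff_subset hR.disj))
  have hdis : Disjoint R (Y₁ \ (S ∪ R) ∪ Y₂ \ (S ∪ R)) := disjoint_left.2 fun v hv hv' => by
    simp only [mem_union, mem_sdiff, not_or] at hv'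
    tauto
  have hAB : Disjoint A B := disjoint_left.2 fun v hv hv' =>
    (mem_sdiff.1 (mem_sdiff.1 hv').1).2 hv
  refine ⟨A ∪ B, union_subset (filter_subset _ _) (sdiff_subset.trans sdiff_subset), _,
    (hc₀'.union hc₁ hdis hAB).mono ?_, ?_, ?_⟩
  · refine union_subset ((hRY.trans sdiff_subset).trans subset_union_right) ?_
    exact union_subset_union sdiff_subset sdiff_subset
  · intro z hz v hv hv'
    by_cases hzA : z ∈ A
    · simp only [hzA, if_true] at hv
      have h1 := (hc₀'.link z hzA).mem v hv
      rcases mem_union.1 hv' with h2 | h2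
      · exact (mem_sdiff.1 (hRY h1)).2 h2
      · exact (mem_sdiff.1 h2).2 h1
    · simp only [hzA, if_false] at hv
      have h1 := (hc₁.link z ((mem_union.1 hz).resolve_left hzA)).mem v hv
      have h2 : v ∈ S := by
        rcases mem_union.1 hv' with h2 | h2
        · exact hZS (mem_filter.1 h2).1
        · exact hZS (mem_sdiff.1 (mem_sdiff.1 h2).1).1
      simp only [mem_union, mem_sdiff, not_or] at h1
      tauto
  · intro z hz
    by_cases hzA : z ∈ A
    · exact Or.inl (mem_union_left _ hzA)
    by_cases hzR : z ∈ R
    · obtain ⟨j, hj, hv⟩ := mem_biUnion.1 hzR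
      exact Or.inr ⟨j, mem_union_left _ hj, by simpa [hj] using hv⟩
    · exact Or.inl (mem_union_right _ (by simp [hB, hz, hzA, hzR]))

end reservoir

section short

theorem nodup_flatten_map_toList {α β : Type} {s : Finset α} {f : α → List β}
    (h1 : ∀ a ∈ s, (f a).Nodup) (h2 : ∀ a ∈ s, ∀ a' ∈ s, a ≠ a' → (f a).Disjoint (f a')) :
    (s.toList.map f).flatten.Nodup := by
  rw [List.nodup_flatten]
  constructor
  · simpa using h1
  · rw [List.pairwise_map]
    exact s.nodup_toList.pairwise_of_forall_ne fun a ha a' ha' hne =>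
      h2 a (mem_toList.1 ha) a' (mem_toList.1 ha') hne

variable {V : Type} [Fintype V] [DecidableEq V] {G : SimpleGraph V} [DecidableRel G.Adj]
variable {b y D r q d : ℕ} {Y₁ Y₂ : Finset V}

/-- A template all of whose cycles have the same short length. -/
theorem Reservoir.exists_short_template (hR : Reservoir G b y D r q d Y₁ Y₂)
    {H : Finset (V × V × V)} {S U₀ : Finset V} {l : ℕ} (hl : 3 ≤ l ∧ l ≤ 9)
    (body : V × V × V → List (V ⊕ (V × V × V)))
    (hlen : ∀ e ∈ H, (body e).length = l) (hbnd : ∀ e ∈ H, (body e).Nodup)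
    (hbch : ∀ e ∈ H, (body e ++ (body e).take 1).IsChain (TemplateAdj G H))
    (hbr : ∀ e ∈ H, ∀ e', .inr e' ∈ body e ↔ e' = e)
    (hbl : ∀ e ∈ H, ∀ v, .inl v ∈ body e → v ∈ verts e)
    (hdis : ∀ e ∈ H, ∀ e' ∈ H, e ≠ e' → Disjoint (verts e) (verts e'))
    (hHY : ∀ e ∈ H, Disjoint (verts e) (Y₁ ∪ Y₂)) (hHU : ∀ e ∈ H, Disjoint (verts e) U₀)
    (hUY : Disjoint U₀ (Y₁ ∪ Y₂)) (hq : 9 * S.card + 8 * r ≤ q) :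
    ∃ cs : List (List (V ⊕ (V × V × V))), (∀ c ∈ cs, c.length = l) ∧
      cs.length ≤ H.card + S.card ∧
      (∀ c ∈ cs, (c ++ c.take 1).IsChain (TemplateAdj G H)) ∧ cs.flatten.Nodup ∧
      (∀ e, .inr e ∈ cs.flatten ↔ e ∈ H) ∧ (∀ v ∈ S, .inl v ∈ cs.flatten) ∧
      ∀ v ∈ U₀ \ S, .inl v ∉ cs.flatten := by
  classical
  obtain ⟨Z, hZ, c, hc, hcZ, hcov⟩ := hR.exists_loops
    (filter_subset (fun v => ∀ e ∈ H, .inl v ∉ body e) S) (k := l - 1) (by omega) hq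
  have hZc := card_le_card (hZ.trans (filter_subset _ _))
  have hm : ∀ s : V ⊕ (V × V × V),
      s ∈ (H.toList.map body ++ Z.toList.map fun z => (z :: c z).map Sum.inl).flatten ↔
      (∃ e ∈ H, s ∈ body e) ∨ ∃ z ∈ Z, ∃ v, (v = z ∨ v ∈ c z) ∧ s = .inl v := by
    intro s
    simp only [List.flatten_append, List.mem_append, List.mem_flatten, List.mem_map, mem_toList,
      exists_exists_and_eq_and, List.mem_cons, eq_comm (a := s)]
  refine ⟨H.toList.map body ++ Z.toList.map fun z => (z :: c z).map Sum.inl, ?_, ?_, ?_, ?_, ?_, ?_, ?_⟩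
  · intro a ha
    simp only [List.mem_append, List.mem_map, mem_toList] at ha
    rcases ha with ⟨e, he, rfl⟩ | ⟨z, hz, rfl⟩
    · exact hlen e he
    · have := (hc.link z hz).length
      simp; omega
  · simp; omega
  · intro a ha
    rw [List.mem_append, List.mem_map, List.mem_map] at ha
    rcases ha with ⟨e, he, rfl⟩ | ⟨z, hz, rfl⟩
    · exact hbch e (mem_toList.1 he)
    · have h1 := (hc.link z (mem_toList.1 hz)).chain
      rw [← List.map_take, ← List.map_append, List.isChain_map]
      exact h1
  · rw [List.flatten_append, List.nodup_append']
    refine ⟨nodup_flatten_map_toList hbnd ?_, nodup_flatten_map_toList ?_ ?_, ?_⟩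
    · rintro e he e' he' hne (v | a) h1 h2
      · exact disjoint_left.1 (hdis e he e' he' hne) (hbl e he v h1) (hbl e' he' v h2)
      · exact hne (((hbr e he a).1 h1).symm.trans ((hbr e' he' a).1 h2))
    · intro z hz
      refine List.Nodup.map Sum.inl_injective (List.nodup_cons.2 ⟨fun h => ?_, (hc.link z hz).nodup⟩)
      exact hcZ z hz z h hz
    · intro z hz z' hz' hne s h1 h2
      obtain ⟨v, hv, rfl⟩ := List.mem_map.1 h1
      obtain ⟨v', hv', hvv⟩ := List.mem_map.1 h2
      obtain rfl := Sum.inl_injective hvv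
      rcases List.mem_cons.1 hv with rfl | hv <;> rcases List.mem_cons.1 hv' with h | hv'
      · exact hne h
      · exact hcZ z' hz' _ hv' hz
      · exact hcZ z hz _ hv (h ▸ hz')
      · exact hc.disj z hz z' hz' hne hv hv'
    · intro s h1 h2
      simp only [List.mem_flatten, List.mem_map, mem_toList, exists_exists_and_eq_and] at h1 h2
      obtain ⟨e, he, h1⟩ := h1
      obtain ⟨z, hz, v, hv, rfl⟩ := h2
      rcases List.mem_cons.1 hv with rfl | hv
      · exact (mem_filter.1 (hZ hz)).2 e he h1
      · exact disjoint_left.1 (hHY e he) (hbl e he v h1) ((hc.link z hz).mem v hv)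
  · intro e
    rw [hm]
    constructor
    · rintro (⟨e', he', h⟩ | ⟨z, hz, v, -, h⟩)
      · exact ((hbr e' he' e).1 h) ▸ he'
      · cases h
    · exact fun he => Or.inl ⟨e, he, (hbr e he e).2 rfl⟩
  · intro v hv
    rw [hm]
    by_cases hvH : ∀ e ∈ H, .inl v ∉ body e
    · rcases hcov v (mem_filter.2 ⟨hv, hvH⟩) with h | ⟨z, hz, h⟩
      · exact Or.inr ⟨v, h, v, Or.inl rfl, rfl⟩
      · exact Or.inr ⟨z, hz, v, Or.inr h, rfl⟩
    · push Not at hvH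
      exact Or.inl hvH
  · intro v hv
    rw [hm]
    rintro (⟨e, he, h⟩ | ⟨z, hz, v', h, h'⟩)
    · exact disjoint_left.1 (hHU e he) (hbl e he v h) (mem_sdiff.1 hv).1
    · obtain rfl := Sum.inl_injective h'
      rcases h with rfl | h
      · exact (mem_sdiff.1 hv).2 (mem_filter.1 (hZ hz)).1
      · exact disjoint_left.1 hUY (mem_sdiff.1 hv).1 ((hc.link z hz).mem v h)

/-- The cycle through an edge gadget and the vertex matched to it, of length `3` or `4`. -/
def edgeBody (l : ℕ) (e : V × V × V) : List (V ⊕ (V × V × V)) :=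
  [.inl e.1, .inr e, .inl e.2.1] ++ if l = 3 then [] else [.inl e.2.2]

/-- A template all of whose cycles have length `3` or all have length `4`. -/
theorem Reservoir.exists_edge_template (hR : Reservoir G b y D r q d Y₁ Y₂)
    {H : Finset (V × V × V)} {S U₀ : Finset V} {l : ℕ} (hl : l = 3 ∨ l = 4)
    (hadj : ∀ e ∈ H, G.Adj e.1 e.2.1 ∧ G.Adj e.2.2 e.1 ∧ G.Adj e.2.2 e.2.1)
    (hdis : ∀ e ∈ H, ∀ e' ∈ H, e ≠ e' → Disjoint (verts e) (verts e'))
    (hHY : ∀ e ∈ H, Disjoint (verts e) (Y₁ ∪ Y₂)) (hHU : ∀ e ∈ H, Disjoint (verts e) U₀)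
    (hUY : Disjoint U₀ (Y₁ ∪ Y₂)) (hq : 9 * S.card + 8 * r ≤ q) :
    ∃ cs : List (List (V ⊕ (V × V × V))), (∀ c ∈ cs, c.length = l) ∧
      cs.length ≤ H.card + S.card ∧
      (∀ c ∈ cs, (c ++ c.take 1).IsChain (TemplateAdj G H)) ∧ cs.flatten.Nodup ∧
      (∀ e, .inr e ∈ cs.flatten ↔ e ∈ H) ∧ (∀ v ∈ S, .inl v ∈ cs.flatten) ∧
      ∀ v ∈ U₀ \ S, .inl v ∉ cs.flatten := by
  refine hR.exists_short_template (l := l) (by omega) (edgeBody l) ?_ ?_ ?_ ?_ ?_ hdis hHY hHU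
    hUY hq
  all_goals intro e he
  all_goals obtain ⟨h1, h2, h3⟩ := hadj e he
  all_goals rcases hl with rfl | rfl
  all_goals simp [edgeBody, TemplateAdj, mem_verts, he, h1.ne, h2, h2.ne', h3.symm, h3.ne', h1.symm]

end short

section blocks

theorem exists_map_eq {α β : Type} [Nonempty β] :
    ∀ (l : List α) (l' : List β), l.Nodup → l.length = l'.length → ∃ f : α → β, l.map f = l' := by
  classical
  intro l
  induction l with
  | nil =>
    intro l' _ h
    exact ⟨fun _ => Classical.arbitrary β, by simpa [eq_comm] using h⟩
  | cons a l ih =>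
    intro l' hnd h
    obtain ⟨b, l', rfl⟩ := List.exists_cons_of_length_eq_add_one (h.symm.trans List.length_cons)
    obtain ⟨f, hf⟩ := ih l' (List.nodup_cons.1 hnd).2 (by simpa using h)
    refine ⟨Function.update f a b, ?_⟩
    rw [List.map_cons, Function.update_self, ← hf]
    congr 1
    refine List.map_congr_left fun x hx => ?_
    rw [Function.update_of_ne]
    rintro rfl
    exact (List.nodup_cons.1 hnd).1 hx

variable {α β : Type}

/-- Concatenating chains along a successor function gives a chain. -/
theorem isChain_flatMap_of_map_eq {R : β → β → Prop} {f : α → List β} {s : α → β} {nxt : α → α}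
    {e : α} : ∀ (t : List α) (a : α), (a :: t).map nxt = t ++ [e] →
      (∀ x ∈ a :: t, (f x).head? = some (s x)) → (∀ x ∈ a :: t, (f x ++ [s (nxt x)]).IsChain R) →
      ((a :: t).flatMap f ++ [s e]).IsChain R ∧ ((a :: t).flatMap f).head? = some (s a) := by
  intro t
  induction t with
  | nil =>
    intro a h hd hc
    simp only [List.map_cons, List.map_nil, List.nil_append, List.cons.injEq, and_true] at h
    have h1 := hc a (by simp)
    rw [h] at h1
    exact ⟨by simpa using h1, by simpa using hd a (by simp)⟩
  | cons x t ih =>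
    intro a h hd hc
    rw [List.map_cons, List.cons_append, List.cons.injEq] at h
    obtain ⟨h1, h2⟩ := ih x h.2 (fun z hz => hd z (List.mem_cons_of_mem _ hz))
      (fun z hz => hc z (List.mem_cons_of_mem _ hz))
    have h3 := hc a (by simp)
    have h4 := hd a (by simp)
    rw [h.1] at h3
    rw [List.flatMap_cons]
    constructor
    · rw [List.append_assoc, List.isChain_append]
      rw [List.isChain_append] at h3
      refine ⟨h3.1, h1, fun u hu v hv => h3.2.2 u hu v ?_⟩
      rw [List.head?_append, h2] at hv
      simpa using hv
    · rw [List.head?_append, h4]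
      rfl

theorem isChain_flatMap_cyclic {R : β → β → Prop} {f : α → List β} {s : α → β} {nxt : α → α}
    {b : List α} (hb : b ≠ []) (hn : b.map nxt = b.rotate 1)
    (hd : ∀ x ∈ b, (f x).head? = some (s x)) (hc : ∀ x ∈ b, (f x ++ [s (nxt x)]).IsChain R) :
    (b.flatMap f ++ (b.flatMap f).take 1).IsChain R := by
  obtain ⟨a, t, rfl⟩ := List.exists_cons_of_ne_nil hb
  obtain ⟨h1, h2⟩ := isChain_flatMap_of_map_eq t a (by simpa using hn) hd hc
  obtain ⟨w, hw⟩ : ∃ w, (a :: t).flatMap f = s a :: w := by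
    cases hh : (a :: t).flatMap f with
    | nil => rw [hh] at h2; simp at h2
    | cons c w => rw [hh] at h2; simp at h2; exact ⟨w, by rw [h2]⟩
  rw [hw] at h1 ⊢
  simpa using h1

/-- A single block of pieces, with the spacings that make the total length equal to `l`. -/
theorem exists_block [DecidableEq α] {wt : α → ℕ} {b : List α}
    (hb : b ≠ []) (hnd : b.Nodup) (hwt : ∀ x ∈ b, 1 ≤ wt x ∧ wt x ≤ 3) {l : ℕ} (hl : 5 * b.length ≤ l) :
    ∃ (nxt : α → α) (k : α → ℕ), b.map nxt = b.rotate 1 ∧ (b.map fun x => wt x + k x).sum = l ∧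
      (∀ x ∈ b, 2 ≤ k x) ∧ (∀ x ∈ b.dropLast, k x ≤ 8) ∧
      ∀ x ∈ b, k x ≤ 4 + (l - 5 * b.length) := by
  have : Nonempty α := ⟨b.head hb⟩
  obtain ⟨nxt, hn⟩ := exists_map_eq b (b.rotate 1) hnd (by simp)
  obtain ⟨b₀, z, rfl⟩ : ∃ b₀ z, b = b₀ ++ [z] :=
    ⟨_, _, (List.dropLast_append_getLast hb).symm⟩
  have hz : ∀ x ∈ b₀, x ≠ z := by
    rintro x hx rfl
    rw [List.nodup_append'] at hnd
    exact hnd.2.2 hx (by simp)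
  refine ⟨nxt, fun x => (5 - wt x) + if x = z then l - 5 * (b₀ ++ [z]).length else 0, hn,
    ?_, ?_, ?_, ?_⟩
  · have h1 : (b₀.map fun x => wt x +
        ((5 - wt x) + if x = z then l - 5 * (b₀ ++ [z]).length else 0)) = b₀.map fun _ => 5 := by
      refine List.map_congr_left fun x hx => ?_
      have := hwt x (by simp [hx])
      rw [if_neg (hz x hx)]
      omega
    have := hwt z (by simp)
    rw [List.map_append, h1]
    simp at hl ⊢
    omega
  · intro x hx
    have := hwt x hx
    simp only
    omega
  · intro x hx
    rw [List.dropLast_concat] at hx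
    simp only [if_neg (hz x hx)]
    omega
  · intro x hx
    have := hwt x hx
    simp only
    split_ifs <;> omega

/-- Distribution of pieces over long cycles. -/
theorem exists_blocks [DecidableEq α] [Nonempty α] {wt : α → ℕ} :
    ∀ (L : List ℕ) (P : List α), P.Nodup → (∀ x ∈ P, 1 ≤ wt x ∧ wt x ≤ 3) → (∀ l ∈ L, 5 ≤ l) →
      9 * P.length ≤ L.sum → ∃ (B : List (List α)) (nxt : α → α) (k : α → ℕ) (rest : List ℕ),
        B.flatten = P ∧ (∀ b ∈ B, b ≠ [] ∧ b.map nxt = b.rotate 1) ∧ (P.map nxt).Perm P ∧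
        (B.map fun b => (b.map fun x => wt x + k x).sum) ++ rest = L ∧
        (∀ x ∈ P, 2 ≤ k x) ∧ ∀ x ∈ P.dropLast, k x ≤ 8 := by
  intro L
  induction L with
  | nil =>
    intro P _ _ _ h
    obtain rfl : P = [] := by simpa using h
    exact ⟨[], id, fun _ => 2, [], by simp⟩
  | cons l L ih =>
    intro P hnd hwt hL h
    rcases eq_or_ne P [] with rfl | hP
    · exact ⟨[], id, fun _ => 2, l :: L, by simp⟩
    have hl := hL l (by simp)
    rw [List.sum_cons] at h
    by_cases hj : 5 * P.length ≤ l
    · obtain ⟨nxt, k, h1, h2, h3, h4, h5⟩ := exists_block hP hnd hwt hj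
      refine ⟨[P], nxt, k, L, by simp, by simp [hP, h1], ?_, by
        rw [List.map_singleton, h2, List.singleton_append], h3, h4⟩
      rw [h1]
      exact List.rotate_perm _ _
    · have hlen : (P.take (l / 5)).length = l / 5 := by rw [List.length_take]; omega
      have hnd' : (P.take (l / 5) ++ P.drop (l / 5)).Nodup := by rwa [List.take_append_drop]
      rw [List.nodup_append'] at hnd'
      have hne : P.take (l / 5) ≠ [] := by
        rw [← List.length_pos_iff, hlen]; omega
      have hne' : P.drop (l / 5) ≠ [] := by
        rw [← List.length_pos_iff, List.length_drop]; omega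
      obtain ⟨nxt, k, h1, h2, h3, h4, h5⟩ := exists_block hne hnd'.1
        (fun x hx => hwt x (List.mem_of_mem_take hx)) (l := l) (by rw [hlen]; omega)
      obtain ⟨B, nxt', k', rest, g1, g2, g3, g4, g5, g6⟩ := ih (P.drop (l / 5)) hnd'.2.1
        (fun x hx => hwt x (List.mem_of_mem_drop hx)) (fun x hx => hL x (List.mem_cons_of_mem _ hx))
        (by rw [List.length_drop]; omega)
      have hout : ∀ x ∈ P.drop (l / 5), x ∉ P.take (l / 5) := fun x hx hx' => hnd'.2.2 hx' hx
      have hBout : ∀ b ∈ B, ∀ x ∈ b, x ∉ P.take (l / 5) := fun b hb x hx =>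
        hout x (g1 ▸ List.mem_flatten.2 ⟨b, hb, hx⟩)
      set Q := P.take (l / 5) with hQ
      have hPQ : P = Q ++ P.drop (l / 5) := (List.take_append_drop _ _).symm
      have e1 : (Q.map fun x => if x ∈ Q then nxt x else nxt' x) = Q.rotate 1 := by
        rw [← h1]; exact List.map_congr_left fun x hx => if_pos hx
      refine ⟨Q :: B, fun x => if x ∈ Q then nxt x else nxt' x,
        fun x => if x ∈ Q then k x else k' x, rest, ?_, ?_, ?_, ?_, ?_, ?_⟩
      · rw [List.flatten_cons, g1, ← hPQ]
      · intro b hb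
        rcases List.mem_cons.1 hb with rfl | hb
        · exact ⟨hne, e1⟩
        · refine ⟨(g2 b hb).1, ?_⟩
          rw [← (g2 b hb).2]
          exact List.map_congr_left fun x hx => if_neg (hBout b hb x hx)
      · have e2 : ((P.drop (l / 5)).map fun x => if x ∈ Q then nxt x else nxt' x) =
            (P.drop (l / 5)).map nxt' := List.map_congr_left fun x hx => if_neg (hout x hx)
        rw [hPQ, List.map_append, ← hPQ, e1, e2]
        conv_rhs => rw [hPQ]
        exact (List.rotate_perm _ _).append g3
      · rw [List.map_cons, List.cons_append]
        congr 1
        · rw [← h2]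
          exact congrArg _ (List.map_congr_left fun x hx => by simp only [if_pos hx])
        · rw [← g4]
          congr 1
          refine List.map_congr_left fun b hb => ?_
          exact congrArg _ (List.map_congr_left fun x hx => by
            simp only [if_neg (hBout b hb x hx)])
      · intro x hx
        rw [hPQ, List.mem_append] at hx
        simp only
        split_ifs with hxQ
        · exact h3 x hxQ
        · exact g5 x (hx.resolve_left hxQ)
      · intro x hx
        rw [hPQ, List.dropLast_append_of_ne_nil hne', List.mem_append] at hx
        simp only
        split_ifs with hxQ
        · have := h5 x hxQ
          omega
        · exact g6 x (hx.resolve_left hxQ)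

end blocks

section long

variable {V : Type} [Fintype V] [DecidableEq V] {G : SimpleGraph V} [DecidableRel G.Adj]

/-- The path through a piece: a single vertex, or a gadget with its matched vertex inside. -/
def piecePath : V ⊕ (V × V × V) → List (V ⊕ (V × V × V))
  | .inl z => [.inl z]
  | .inr e => [.inl e.1, .inr e, .inl e.2.1]

/-- The first vertex of a piece. -/
def pieceStart : V ⊕ (V × V × V) → V
  | .inl z => z
  | .inr e => e.1

/-- The last vertex of a piece. -/
def pieceEnd : V ⊕ (V × V × V) → V
  | .inl z => z
  | .inr e => e.2.1

/-- The set of graph vertices on a piece. -/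
def pieceVerts : V ⊕ (V × V × V) → Finset V
  | .inl z => {z}
  | .inr e => verts e

theorem pieceStart_mem (x : V ⊕ (V × V × V)) : pieceStart x ∈ pieceVerts x := by
  rcases x with z | e <;> simp [pieceStart, pieceVerts, mem_verts]

theorem pieceEnd_mem (x : V ⊕ (V × V × V)) : pieceEnd x ∈ pieceVerts x := by
  rcases x with z | e <;> simp [pieceEnd, pieceVerts, mem_verts]

theorem mem_pieceVerts_of_mem_piecePath {x : V ⊕ (V × V × V)} {v : V}
    (h : .inl v ∈ piecePath x) : v ∈ pieceVerts x := by
  rcases x with z | e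
  · simpa [piecePath, pieceVerts] using h
  · simp only [piecePath, List.mem_cons, Sum.inl.injEq, reduceCtorEq, List.not_mem_nil, or_false,
      false_or] at h
    simp only [pieceVerts, mem_verts]
    tauto

theorem inr_mem_piecePath {x : V ⊕ (V × V × V)} {e : V × V × V} :
    .inr e ∈ piecePath x ↔ x = .inr e := by
  rcases x with z | e'
  · simp [piecePath]
  · simp [piecePath, eq_comm]

variable {b y D r q d : ℕ} {Y₁ Y₂ : Finset V}

/-- Links between all pieces, the last of which may be arbitrarily long. -/
theorem Reservoir.exists_piece_linkage (hR : Reservoir G b y D r q d Y₁ Y₂)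
    {S F : Finset V} {Q : Finset (V ⊕ (V × V × V))} {z : V ⊕ (V × V × V)} (hz : z ∈ Q)
    {nxt : V ⊕ (V × V × V) → V ⊕ (V × V × V)} {k : V ⊕ (V × V × V) → ℕ}
    (hnd : ∀ x ∈ Q, ∀ x' ∈ Q, x ≠ x' → Disjoint (pieceVerts x) (pieceVerts x'))
    (hnxt : ∀ x ∈ Q, nxt x ∈ Q) (hinj : Set.InjOn nxt Q)
    (hk : ∀ x ∈ Q, 2 ≤ k x) (hk8 : ∀ x ∈ Q, x ≠ z → k x ≤ 8)
    (hSD : S.card ≤ D) (hq : S.card + 8 * Q.card ≤ q)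
    (hF₁ : Disjoint (Y₁ \ S) F) (hF₂ : Disjoint (Y₂ \ S) F)
    (hFc : F.card + ∑ x ∈ Q, k x + y + b ≤ Fintype.card V) :
    ∃ c, Linkage G Q pieceEnd (fun x => pieceStart (nxt x)) k (univ \ F) c := by
  have hdeg := hR.le_deg
  have hs₁ := hR.size₁
  have hs₂ := hR.size₂
  have hE : Set.InjOn pieceEnd (Q : Set (V ⊕ (V × V × V))) := by
    intro x hx x' hx' h
    by_contra hne
    exact disjoint_left.1 (hnd x hx x' hx' hne) (pieceEnd_mem x) (h ▸ pieceEnd_mem x')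
  have hSt : Set.InjOn pieceStart (Q : Set (V ⊕ (V × V × V))) := by
    intro x hx x' hx' h
    by_contra hne
    exact disjoint_left.1 (hnd x hx x' hx' hne) (pieceStart_mem x) (h ▸ pieceStart_mem x')
  have hsub : (Q.erase z : Set (V ⊕ (V × V × V))) ⊆ Q := by
    exact_mod_cast erase_subset z Q
  have hJ : (Q.erase z).card ≤ Q.card := card_le_card (erase_subset _ _)
  have hnb : ∀ v, d ≤ (nb G v (Y₂ \ S)).card + D := fun v => by
    have h1 := card_nb_sdiff (G := G) v Y₂ S
    have h2 := card_le_card (nb_subset (G := G) v S)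
    have h3 := hR.deg₂ v
    omega
  have hYS := le_card_sdiff S Y₂
  obtain ⟨c, hc, hcr⟩ := hR.exp.exists_linkage_two_rounds (u := pieceEnd)
    (w := fun x => pieceStart (nxt x)) (k := k) (Q.erase z) Y₁ (Y₂ \ S) S D r
    (fun j hj => ⟨hk j (mem_of_mem_erase hj), hk8 j (mem_of_mem_erase hj) (ne_of_mem_erase hj)⟩)
    (hE.mono hsub) (hSt.comp (hinj.mono hsub) fun x hx => hnxt x (hsub hx))
    (fun X W hW => hR.few X W (by omega))
    (fun j _ => by have := hR.deg₁ (pieceEnd j); omega)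
    (fun j _ => by have := hR.deg₁ (pieceStart (nxt j)); omega) (by omega)
    (fun j _ => by have := hnb (pieceEnd j); omega)
    (fun j _ => by have := hnb (pieceStart (nxt j)); omega) (by omega)
    (disjoint_of_subset_left sdiff_subset (disjoint_of_subset_right sdiff_subset hR.disj))
  have hc' : Linkage G (Q.erase z) pieceEnd (fun x => pieceStart (nxt x)) k (univ \ F) c := by
    refine hc.mono fun v hv => mem_sdiff.2 ⟨mem_univ _, fun hvF => ?_⟩
    rcases mem_union.1 hv with hv | hv
    · exact disjoint_left.1 hF₁ hv hvF
    · exact disjoint_left.1 hF₂ hv hvF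
  set R := (Q.erase z).biUnion fun j => (c j).toFinset with hRdef
  have hRc : R.card ≤ ∑ x ∈ Q.erase z, k x := by
    refine card_biUnion_le.trans (sum_le_sum fun x hx => ?_)
    exact (List.toFinset_card_le _).trans (hc.link x hx).length.le
  have hsum : k z + ∑ x ∈ Q.erase z, k x = ∑ x ∈ Q, k x := add_sum_erase _ _ hz
  have hfin : ∀ v, d ≤ (nb G v ((univ \ F) \ R)).card + D + 16 * r := fun v => by
    have h1 := card_nb_sdiff (G := G) v (Y₂ \ S) (R ∩ (Y₂ \ S))
    have h2 := card_le_card (nb_subset (G := G) v (R ∩ (Y₂ \ S)))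
    have h3 : (nb G v ((Y₂ \ S) \ (R ∩ (Y₂ \ S)))).card ≤ (nb G v ((univ \ F) \ R)).card := by
      refine card_le_card (nb_mono _ fun u hu => ?_)
      have h4 := mem_sdiff.1 hu
      refine mem_sdiff.2 ⟨mem_sdiff.2 ⟨mem_univ _, fun h => disjoint_left.1 hF₂ h4.1 h⟩,
        fun h => h4.2 (mem_inter.2 ⟨h, h4.1⟩)⟩
    have h5 := hnb v
    omega
  have hcard : k z + y + b ≤ ((univ \ F) \ R).card := by
    have h1 := le_card_sdiff R (univ \ F)
    have h2 := le_card_sdiff F (univ : Finset V)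
    rw [card_univ] at h2
    omega
  have := hc'.extend hR.exp (notMem_erase z Q) (hk z hz)
    (by rw [← hRdef]; have := hfin (pieceEnd z); omega)
    (by rw [← hRdef]; have := hfin (pieceStart (nxt z)); omega) hcard
  rwa [insert_erase hz] at this

/-- A template distributing all pieces over cycles of length at least `5`. -/
theorem Reservoir.exists_long_template (hR : Reservoir G b y D r q d Y₁ Y₂)
    {H : Finset (V × V × V)} {S U₀ : Finset V} {L : List ℕ} (hL : ∀ l ∈ L, 5 ≤ l)
    (hLsum : 9 * (H.card + S.card) ≤ L.sum) (hLn : L.sum ≤ Fintype.card V) (hHne : H.Nonempty)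
    (hgad : ∀ e ∈ H, e.1 ≠ e.2.1 ∧ e.2.2 = e.1)
    (hdis : ∀ e ∈ H, ∀ e' ∈ H, e ≠ e' → Disjoint (verts e) (verts e'))
    (hHY : ∀ e ∈ H, Disjoint (verts e) (Y₁ ∪ Y₂)) (hHU : ∀ e ∈ H, Disjoint (verts e) U₀)
    (hUY : Disjoint U₀ (Y₁ ∪ Y₂)) (hSD : S.card ≤ D) (hq : 9 * S.card + 8 * H.card ≤ q)
    (hslack : U₀.card + y + b ≤ H.card) :
    ∃ (cs : List (List (V ⊕ (V × V × V)))) (rest : List ℕ), cs.map List.length ++ rest = L ∧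
      (∀ c ∈ cs, (c ++ c.take 1).IsChain (TemplateAdj G H)) ∧ cs.flatten.Nodup ∧
      (∀ e, .inr e ∈ cs.flatten ↔ e ∈ H) ∧ (∀ v ∈ S, .inl v ∈ cs.flatten) ∧
      ∀ v ∈ U₀ \ S, .inl v ∉ cs.flatten := by
  set Z := S \ H.biUnion verts with hZ
  set Q : Finset (V ⊕ (V × V × V)) := Z.disjSum H with hQ
  have hZc : Z.card ≤ S.card := card_le_card sdiff_subset
  have hQc : Q.card = Z.card + H.card := card_disjSum _ _
  have hnd : ∀ x ∈ Q, ∀ x' ∈ Q, x ≠ x' → Disjoint (pieceVerts x) (pieceVerts x') := by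
    have hcross : ∀ v ∈ Z, ∀ e ∈ H, v ∉ verts e := fun v hv e he h =>
      (mem_sdiff.1 hv).2 (mem_biUnion.2 ⟨e, he, h⟩)
    rintro (v | e) hx (v' | e') hx' hne
    · simpa [pieceVerts, eq_comm] using hne
    · exact disjoint_singleton_left.2 (hcross v (inl_mem_disjSum.1 hx) e' (inr_mem_disjSum.1 hx'))
    · exact disjoint_singleton_right.2 (hcross v' (inl_mem_disjSum.1 hx') e (inr_mem_disjSum.1 hx))
    · exact hdis e (inr_mem_disjSum.1 hx) e' (inr_mem_disjSum.1 hx') fun h => hne (h ▸ rfl)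
  obtain ⟨e₀, he₀⟩ := hHne
  have : Nonempty (V ⊕ (V × V × V)) := ⟨.inr e₀⟩
  obtain ⟨B, nxt, k, rest, h1, h2, h3, h4, h5, h6⟩ := exists_blocks
    (wt := fun x : V ⊕ (V × V × V) => (piecePath x).length) L Q.toList Q.nodup_toList
    (fun x _ => by rcases x with v | e <;> simp [piecePath]) hL (by rw [length_toList]; omega)
  have hne : Q.toList ≠ [] := by
    rw [Ne, toList_eq_nil, ← Ne, ← nonempty_iff_ne_empty]
    exact ⟨.inr e₀, inr_mem_disjSum.2 he₀⟩
  obtain ⟨P₀, z, hP⟩ : ∃ P₀ z, Q.toList = P₀ ++ [z] :=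
    ⟨_, _, (List.dropLast_append_getLast hne).symm⟩
  have htot : ∑ x ∈ Q, ((piecePath x).length + k x) ≤ Fintype.card V := by
    rw [← sum_map_toList, ← h1, List.map_flatten, List.sum_flatten, List.map_map]
    refine le_trans ?_ hLn
    rw [← h4, List.sum_append]
    exact Nat.le_add_right _ _
  rw [sum_add_distrib] at htot
  have hwt : ∑ x ∈ Q, (piecePath x).length = Z.card + 3 * H.card := by
    rw [hQ, sum_disjSum]
    simp [piecePath, mul_comm]
  have hvc : (H.biUnion verts).card ≤ 2 * H.card := by
    rw [mul_comm]
    refine card_biUnion_le_card_mul _ _ _ fun e he => ?_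
    have : verts e = {e.1, e.2.1} := by
      ext v
      rw [mem_verts, (hgad e he).2]
      simp only [mem_insert, mem_singleton]
      tauto
    rw [this]
    exact card_le_two
  have hFc := (card_union_le U₀ (Z ∪ H.biUnion verts)).trans
    (Nat.add_le_add_left (card_union_le _ _) _)
  have hYF : ∀ v ∈ Y₁ ∪ Y₂, v ∉ S → v ∉ U₀ ∪ (Z ∪ H.biUnion verts) := by
    intro v hv hvS hvF
    rcases mem_union.1 hvF with h | h
    · exact disjoint_left.1 hUY h hv
    rcases mem_union.1 h with h | h
    · exact hvS (mem_sdiff.1 h).1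
    · obtain ⟨e, he, h⟩ := mem_biUnion.1 h
      exact disjoint_left.1 (hHY e he) h hv
  have hinj : Set.InjOn nxt Q := fun x hx x' hx' h =>
    List.inj_on_of_nodup_map (h3.nodup_iff.2 Q.nodup_toList) (mem_toList.2 hx) (mem_toList.2 hx') h
  have hnxt : ∀ x ∈ Q, nxt x ∈ Q := fun x hx =>
    mem_toList.1 (h3.subset (List.mem_map_of_mem (mem_toList.2 hx)))
  obtain ⟨c, hc⟩ := hR.exists_piece_linkage (S := S) (F := U₀ ∪ (Z ∪ H.biUnion verts)) (z := z)
    (mem_toList.1 (by rw [hP]; simp)) hnd hnxt hinj (fun x hx => h5 x (mem_toList.2 hx))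
    (fun x hx hxz => h6 x (by
      have := mem_toList.2 hx
      rw [hP] at this ⊢
      rw [List.dropLast_concat]
      simpa [hxz] using this)) hSD (by omega)
    (disjoint_left.2 fun v hv => hYF v (mem_union_left _ (mem_sdiff.1 hv).1) (mem_sdiff.1 hv).2)
    (disjoint_left.2 fun v hv => hYF v (mem_union_right _ (mem_sdiff.1 hv).1) (mem_sdiff.1 hv).2)
    (by omega)
  set f : V ⊕ (V × V × V) → List (V ⊕ (V × V × V)) :=
    fun x => piecePath x ++ (c x).map Sum.inl with hf
  have hcF : ∀ x ∈ Q, ∀ v ∈ c x, v ∉ U₀ ∪ (Z ∪ H.biUnion verts) := fun x hx v hv =>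
    (mem_sdiff.1 ((hc.link x hx).mem v hv)).2
  have hpF : ∀ x ∈ Q, ∀ v ∈ pieceVerts x, v ∈ Z ∪ H.biUnion verts := by
    rintro (w | e) hx v hv
    · rw [mem_singleton.1 hv]
      exact mem_union_left _ (inl_mem_disjSum.1 hx)
    · exact mem_union_right _ (mem_biUnion.2 ⟨e, inr_mem_disjSum.1 hx, hv⟩)
  have hflat : (B.map fun b => b.flatMap f).flatten = (Q.toList.map f).flatten := by
    rw [← h1]
    simp [List.flatMap_def, List.map_flatten, List.flatten_flatten, Function.comp_def]
  have hmem : ∀ s, s ∈ (Q.toList.map f).flatten ↔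
      ∃ x ∈ Q, s ∈ piecePath x ∨ ∃ v ∈ c x, .inl v = s := by
    intro s
    simp only [hf, List.mem_flatten, List.mem_map, mem_toList, exists_exists_and_eq_and,
      List.mem_append]
  have hBQ : ∀ b ∈ B, ∀ x ∈ b, x ∈ Q := fun b hb x hx =>
    mem_toList.1 (h1 ▸ List.mem_flatten.2 ⟨b, hb, hx⟩)
  refine ⟨B.map fun b => b.flatMap f, rest, ?_, ?_, ?_, ?_, ?_, ?_⟩
  · rw [← h4, List.map_map]
    congr 1
    refine List.map_congr_left fun b hb => ?_
    rw [Function.comp_apply, List.length_flatMap]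
    refine congrArg _ (List.map_congr_left fun x hx => ?_)
    simp [hf, (hc.link x (hBQ b hb x hx)).length]
  · intro a ha
    obtain ⟨b, hb, rfl⟩ := List.mem_map.1 ha
    refine isChain_flatMap_cyclic (s := fun x => .inl (pieceStart x)) (h2 b hb).1 (h2 b hb).2 ?_ ?_
    · rintro (v | e) _ <;> simp [hf, piecePath, pieceStart]
    · intro x hx
      have h7 := (hc.link x (hBQ b hb x hx)).chain
      have h8 : ((pieceEnd x :: (c x ++ [pieceStart (nxt x)])).map
          (Sum.inl : V → V ⊕ (V × V × V))).IsChain (TemplateAdj G H) := by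
        rw [List.isChain_map]
        exact h7
      have hxQ := hBQ b hb x hx
      rcases x with v | e
      · simpa [hf, piecePath, pieceEnd] using h8
      · have he : e ∈ H := inr_mem_disjSum.1 hxQ
        simpa [hf, piecePath, pieceEnd, TemplateAdj, he] using h8
  · rw [hflat]
    refine nodup_flatten_map_toList ?_ ?_
    · intro x hx
      refine List.nodup_append'.2 ⟨?_, (hc.link x hx).nodup.map Sum.inl_injective, ?_⟩
      · rcases x with v | e
        · simp [piecePath]
        · simpa [piecePath] using (hgad e (inr_mem_disjSum.1 hx)).1
      · intro s hs hs'
        obtain ⟨v, hv, rfl⟩ := List.mem_map.1 hs'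
        exact hcF x hx v hv (mem_union_right _
          (hpF x hx v (mem_pieceVerts_of_mem_piecePath hs)))
    · rintro x hx x' hx' hne s hs hs'
      rcases List.mem_append.1 hs with hs | hs <;> rcases List.mem_append.1 hs' with hs' | hs'
      · rcases s with v | e
        · exact disjoint_left.1 (hnd x hx x' hx' hne) (mem_pieceVerts_of_mem_piecePath hs)
            (mem_pieceVerts_of_mem_piecePath hs')
        · exact hne ((inr_mem_piecePath.1 hs).trans (inr_mem_piecePath.1 hs').symm)
      · obtain ⟨v, hv, rfl⟩ := List.mem_map.1 hs'
        exact hcF x' hx' v hv (mem_union_right _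
          (hpF x hx v (mem_pieceVerts_of_mem_piecePath hs)))
      · obtain ⟨v, hv, rfl⟩ := List.mem_map.1 hs
        exact hcF x hx v hv (mem_union_right _
          (hpF x' hx' v (mem_pieceVerts_of_mem_piecePath hs')))
      · obtain ⟨v, hv, rfl⟩ := List.mem_map.1 hs
        obtain ⟨v', hv', h⟩ := List.mem_map.1 hs'
        exact hc.disj x hx x' hx' hne hv (Sum.inl_injective h ▸ hv')
  · intro e
    rw [hflat, hmem]
    constructor
    · rintro ⟨x, hx, h | ⟨v, _, h⟩⟩
      · rw [inr_mem_piecePath.1 h] at hx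
        exact inr_mem_disjSum.1 hx
      · cases h
    · exact fun he => ⟨.inr e, inr_mem_disjSum.2 he, Or.inl (inr_mem_piecePath.2 rfl)⟩
  · intro v hv
    rw [hflat, hmem]
    by_cases hvH : v ∈ H.biUnion verts
    · obtain ⟨e, he, hve⟩ := mem_biUnion.1 hvH
      refine ⟨.inr e, inr_mem_disjSum.2 he, Or.inl ?_⟩
      rw [mem_verts, (hgad e he).2] at hve
      simp only [piecePath, List.mem_cons, Sum.inl.injEq, reduceCtorEq, List.not_mem_nil, or_false,
        false_or]
      tauto
    · exact ⟨.inl v, inl_mem_disjSum.2 (mem_sdiff.2 ⟨hv, hvH⟩), Or.inl (by simp [piecePath])⟩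
  · intro v hv
    rw [hflat, hmem]
    rintro ⟨x, hx, h | ⟨u, hu, h⟩⟩
    · have h7 := hpF x hx v (mem_pieceVerts_of_mem_piecePath h)
      rcases mem_union.1 h7 with h7 | h7
      · exact (mem_sdiff.1 hv).2 (mem_sdiff.1 h7).1
      · obtain ⟨e, he, h7⟩ := mem_biUnion.1 h7
        exact disjoint_left.1 (hHU e he) h7 (mem_sdiff.1 hv).1
    · obtain rfl := Sum.inl_injective h
      exact hcF x hx u hu (mem_union_left _ (mem_sdiff.1 hv).1)

end long

section split

theorem two_mul_succ_mul_lt {n N : ℕ} (hn : 3 ≤ n) (hN : 220 * Real.log n ≤ N) :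
    2 * (n + 1) * 2 ^ (2 * N / 5) * 3 ^ N < 4 ^ N := by
  have hn0 : (0 : ℝ) < n := by positivity
  have h1 : (1 : ℝ) - (1.05)⁻¹ ≤ Real.log 1.05 := Real.one_sub_inv_le_log_of_pos (by norm_num)
  have hlog : 0 < Real.log n := Real.log_pos (by norm_cast; omega)
  have h2 : (n : ℝ) ^ 10 < 1.05 ^ N := by
    rw [← Real.log_lt_log_iff (by positivity) (by positivity), Real.log_pow, Real.log_pow]
    norm_num at h1 ⊢
    nlinarith
  have h3 : (2 * (n + 1) : ℝ) ≤ n ^ 2 := by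
    have : (3 : ℝ) ≤ n := by exact_mod_cast hn
    nlinarith
  have h4 : ((2 * (n + 1) : ℝ) * 2 ^ (2 * N / 5) * 3 ^ N) ^ 5 < (4 ^ N) ^ 5 := by
    have h5 : ((2 : ℝ) ^ (2 * N / 5)) ^ 5 ≤ 4 ^ N := by
      rw [← pow_mul]
      calc (2 : ℝ) ^ (2 * N / 5 * 5) ≤ 2 ^ (2 * N) :=
            pow_le_pow_right₀ (by norm_num) (Nat.div_mul_le_self _ _)
        _ = 4 ^ N := by rw [pow_mul]; norm_num
    have h6 : (2 * (n + 1) : ℝ) ^ 5 < 1.05 ^ N := by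
      refine lt_of_le_of_lt ?_ h2
      calc (2 * (n + 1) : ℝ) ^ 5 ≤ (n ^ 2) ^ 5 := pow_le_pow_left₀ (by positivity) h3 5
        _ = _ := by ring
    rw [mul_pow, mul_pow]
    calc (2 * (n + 1) : ℝ) ^ 5 * (2 ^ (2 * N / 5)) ^ 5 * (3 ^ N) ^ 5
        ≤ (2 * (n + 1) : ℝ) ^ 5 * 4 ^ N * (3 ^ N) ^ 5 := by gcongr
      _ < 1.05 ^ N * 4 ^ N * (3 ^ N) ^ 5 := by gcongr
      _ = (1.05 * 4 * 3 ^ 5) ^ N := by rw [mul_pow, mul_pow, pow_right_comm (3 : ℝ) N 5]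
      _ ≤ (4 ^ 5) ^ N := by gcongr; norm_num
      _ = _ := by rw [← pow_mul, ← pow_mul, mul_comm]
  exact_mod_cast lt_of_pow_lt_pow_left₀ 5 (by positivity) h4

/-- The vertex set can be split into three parts such that every vertex has a constant proportion
of its neighbours in each of the first two. -/
theorem exists_split {V : Type} [Fintype V] [DecidableEq V] (G : SimpleGraph V)
    [DecidableRel G.Adj] {d : ℕ} (hn : 3 ≤ Fintype.card V)
    (hd : 220 * Real.log (Fintype.card V) ≤ d) (hdn : d ≤ 2 * Fintype.card V / 5)
    (hdeg : ∀ v, d ≤ 2 * G.degree v / 5) :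
    ∃ Y₁ Y₂ : Finset V, Disjoint Y₁ Y₂ ∧ (∀ v, 2 * d / 5 ≤ (nb G v Y₁).card) ∧
      (∀ v, 2 * d / 5 ≤ (nb G v Y₂).card) ∧
      2 * (2 * Fintype.card V / 5) / 5 ≤ Y₁.card ∧ 2 * (2 * Fintype.card V / 5) / 5 ≤ Y₂.card ∧
      2 * (2 * Fintype.card V / 5) / 5 ≤ (univ \ (Y₁ ∪ Y₂)).card := by
  set N : Option V → Finset V := fun i => i.elim univ fun v => nb G v univ with hN
  have hcard : (univ : Finset (Option V)).card = Fintype.card V + 1 := by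
    rw [card_univ, Fintype.card_option]
  have hNd : ∀ i, d ≤ 2 * (N i).card / 5 := by
    rintro (_ | v)
    · simpa [hN] using hdn
    · have : (nb G v univ).card = G.degree v := by
        rw [← SimpleGraph.card_neighborFinset_eq_degree]
        congr 1
        ext u
        simp [mem_nb]
      simpa [hN, this] using hdeg v
  have hlt : ∀ m : ℕ, d ≤ m → 2 * (univ : Finset (Option V)).card * 2 ^ (2 * m / 5) * 3 ^ m
      < 4 ^ m := fun m hm => by
    rw [hcard]
    exact two_mul_succ_mul_lt hn (hd.trans (by exact_mod_cast hm))
  obtain ⟨X, hX⟩ := exists_balanced_subset univ N (fun i => 2 * (N i).card / 5)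
    fun i _ => hlt _ ((hNd i).trans (by omega))
  obtain ⟨X', hX'⟩ := exists_balanced_subset univ (fun i => N i \ X)
    (fun i => 2 * (N i \ X).card / 5)
    fun i _ => hlt _ ((hNd i).trans (hX i (mem_univ _)).2)
  have hnb : ∀ v Y, nb G v univ ∩ Y = nb G v Y := fun v Y => by
    ext u
    simp [mem_nb, and_comm]
  have h1 := fun v => hNd (some v)
  have h2 := fun v => hX (some v) (mem_univ _)
  have h3 := fun v => hX' (some v) (mem_univ _)
  have h4 := hX none (mem_univ _)
  have h5 := hX' none (mem_univ _)
  simp only [hN, Option.elim] at h1 h2 h3 h4 h5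
  rw [card_univ] at h4
  have h6 : (univ \ X) ∩ X' = X' \ X := by ext; simp [and_comm]
  have h7 : (univ \ X) \ X' = univ \ (X ∪ X' \ X) := by ext; simp
  have h8 : ∀ v, (nb G v univ \ X) ∩ X' = nb G v (X' \ X) := fun v => by
    ext; simp [mem_nb]; tauto
  simp only [hnb] at h2
  simp only [h8] at h3
  rw [h6, h7] at h5
  rw [univ_inter] at h4
  refine ⟨X, X' \ X, disjoint_sdiff, fun v => ?_, fun v => ?_, ?_, ?_, ?_⟩
  · have := h1 v; have := h2 v; omega
  · have := h1 v; have := h2 v; have := h3 v; omega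
  all_goals omega

end split

section cases

variable {V : Type} [Fintype V] [DecidableEq V] {G : SimpleGraph V} [DecidableRel G.Adj]

theorem exists_absorber (M : Finset (V × V × V)) {W₀ : Finset V} {K s z u : ℕ}
    (hX : ∀ X : Finset V, s ≤ X.card →
      K * (M.filter fun e => ∀ v ∈ X, ¬ Hits G v e).card ≤ Fintype.card V + M.card)
    (hK : Fintype.card V + M.card < K * (z + 1)) (hM : 2 * s + 2 * z < M.card)
    (hu : 2 * s + 2 * z ≤ u) (hW : 3 * M.card + u ≤ W₀.card) :
    ∃ (U₀ S : Finset V) (T : Finset (V × V × V)), U₀ ⊆ W₀ ∧ U₀.card = u ∧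
      (∀ e ∈ M, Disjoint (verts e) U₀) ∧ S.card ≤ s ∧ T ⊆ M ∧ T.card ≤ z ∧
      ∀ U : Finset V, U₀ \ S ⊆ U → Disjoint U S → U.card = (M \ T).card →
        ∃ f : V × V × V → V, (∀ e ∈ M \ T, f e ∈ U ∧ Hits G (f e) e) ∧
          Set.InjOn f (M \ T : Finset (V × V × V)) := by
  have hc : (M.biUnion verts).card ≤ 3 * M.card := by
    rw [mul_comm]
    exact card_biUnion_le_card_mul _ _ _ fun e _ => card_le_three
  obtain ⟨U₀, hU₀, hU₀c⟩ := exists_subset_card_eq (s := W₀ \ M.biUnion verts) (n := u)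
    (by have := le_card_sdiff (M.biUnion verts) W₀; omega)
  obtain ⟨S, T, hS, hT, hTz, hf⟩ := exists_flexible_matching M U₀ (Hits G) s z
    (fun X hXs => Nat.lt_succ_iff.1 (lt_of_mul_lt_mul_left' ((hX X hXs).trans_lt hK))) hM
    (hU₀c ▸ hu)
  refine ⟨U₀, S, T, hU₀.trans sdiff_subset, hU₀c, fun e he => disjoint_right.2 fun v hv hve =>
    (mem_sdiff.1 (hU₀ hv)).2 (mem_biUnion.2 ⟨e, he, hve⟩), hS, hT, hTz, fun U h1 h2 h3 => ?_⟩
  exact hf U h1 h2 (by have := card_sdiff_add_card_eq_card hT; omega)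

variable {b y D r q d : ℕ} {Y₁ Y₂ : Finset V}

/-- If many of the prescribed cycles have the same length `3` or `4`, then the template consists of
cycles of that length. -/
theorem Reservoir.exists_two_factor_of_count (hR : Reservoir G b y D r q d Y₁ Y₂) {t : ℕ}
    {ℓ : Fin t → ℕ} (h3 : ∀ i, 3 ≤ ℓ i) (hsum : ∑ i, ℓ i = Fintype.card V) {l : ℕ}
    (hl : l = 3 ∨ l = 4) {M : Finset (V × V × V)} {W₀ : Finset V} {K s z u : ℕ}
    (hcount : M.card + s ≤ (List.ofFn ℓ).count l) (hWY : Disjoint W₀ (Y₁ ∪ Y₂))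
    (hMW : ∀ e ∈ M, (G.Adj e.1 e.2.1 ∧ G.Adj e.2.2 e.1 ∧ G.Adj e.2.2 e.2.1) ∧ verts e ⊆ W₀)
    (hdis : ∀ e ∈ M, ∀ e' ∈ M, e ≠ e' → Disjoint (verts e) (verts e'))
    (hX : ∀ X : Finset V, s ≤ X.card →
      K * (M.filter fun e => ∀ v ∈ X, ¬ Hits G v e).card ≤ Fintype.card V + M.card)
    (hK : Fintype.card V + M.card < K * (z + 1)) (hu : 2 * s + 2 * z ≤ u)
    (hW : 3 * M.card + u ≤ W₀.card) (hq : 9 * s + 8 * r ≤ q) (hslack : u + y + b + z ≤ M.card)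
    (hy : 0 < y) :
    ∃ (v : Fin t → V) (c : ∀ i, G.Walk (v i) (v i)),
      (∀ i, (c i).IsCycle ∧ (c i).length = ℓ i) ∧
      (∀ i j, i ≠ j → Disjoint (c i).support.toFinset (c j).support.toFinset) ∧
      Finset.univ.biUnion (fun i => (c i).support.toFinset) = Finset.univ := by
  obtain ⟨U₀, S, T, hUW, hUc, hMU, hS, hT, hTz, hflex⟩ :=
    exists_absorber M hX hK (by omega) hu hW
  have hHM : M \ T ⊆ M := sdiff_subset
  have hHc := card_sdiff_add_card_eq_card hT
  obtain ⟨cs, hcl, hcsl, hch, hnd, hH, hSc, hUcs⟩ := hR.exists_edge_template (H := M \ T) (S := S)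
    (U₀ := U₀) hl (fun e he => (hMW e (hHM he)).1)
    (fun e he e' he' => hdis e (hHM he) e' (hHM he'))
    (fun e he => disjoint_of_subset_left (hMW e (hHM he)).2 hWY) (fun e he => hMU e (hHM he))
    (disjoint_of_subset_left hUW hWY) (by omega)
  have h1 : cs.map List.length = List.replicate cs.length l :=
    List.eq_replicate_iff.2 ⟨List.length_map _, fun x hx => by
      obtain ⟨c, hc, rfl⟩ := List.mem_map.1 hx
      exact hcl c hc⟩
  obtain ⟨rest, hperm⟩ := (h1 ▸ List.replicate_sublist_iff.2 (by omega) :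
    (cs.map List.length).Sublist (List.ofFn ℓ)).exists_perm_append
  exact exists_two_factor_of_template hR.exp h3 hsum hflex (by omega) hch hnd hH hSc hUcs
    hperm.symm

/-- If the prescribed cycles of length at least `5` cover enough vertices, then the template
consists of such cycles. -/
theorem Reservoir.exists_two_factor_of_long (hR : Reservoir G b y D r q d Y₁ Y₂) {t : ℕ}
    {ℓ : Fin t → ℕ} (h3 : ∀ i, 3 ≤ ℓ i) (hsum : ∑ i, ℓ i = Fintype.card V)
    {M : Finset (V × V × V)} {W₀ : Finset V} {K s z u : ℕ}
    (hlong : 9 * (M.card + s) ≤ ((List.ofFn ℓ).filter (5 ≤ ·)).sum)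
    (hWY : Disjoint W₀ (Y₁ ∪ Y₂))
    (hMW : ∀ e ∈ M, (e.1 ≠ e.2.1 ∧ e.2.2 = e.1) ∧ verts e ⊆ W₀)
    (hdis : ∀ e ∈ M, ∀ e' ∈ M, e ≠ e' → Disjoint (verts e) (verts e'))
    (hX : ∀ X : Finset V, s ≤ X.card →
      K * (M.filter fun e => ∀ v ∈ X, ¬ Hits G v e).card ≤ Fintype.card V + M.card)
    (hK : Fintype.card V + M.card < K * (z + 1)) (hu : 2 * s + 2 * z ≤ u)
    (hW : 3 * M.card + u ≤ W₀.card) (hsD : s ≤ D) (hq : 9 * s + 8 * M.card ≤ q)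
    (hslack : u + y + b + z ≤ M.card) (hy : 0 < y) :
    ∃ (v : Fin t → V) (c : ∀ i, G.Walk (v i) (v i)),
      (∀ i, (c i).IsCycle ∧ (c i).length = ℓ i) ∧
      (∀ i j, i ≠ j → Disjoint (c i).support.toFinset (c j).support.toFinset) ∧
      Finset.univ.biUnion (fun i => (c i).support.toFinset) = Finset.univ := by
  obtain ⟨U₀, S, T, hUW, hUc, hMU, hS, hT, hTz, hflex⟩ :=
    exists_absorber M hX hK (by omega) hu hW
  have hHM : M \ T ⊆ M := sdiff_subset
  have hHc := card_sdiff_add_card_eq_card hT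
  have hp := List.filter_append_perm (5 ≤ ·) (List.ofFn ℓ)
  have hLn : ((List.ofFn ℓ).filter (5 ≤ ·)).sum ≤ Fintype.card V := by
    rw [← hsum, ← List.sum_ofFn, ← hp.sum_eq, List.sum_append]
    exact Nat.le_add_right _ _
  obtain ⟨cs, rest, hrest, hch, hnd, hH, hSc, hUcs⟩ := hR.exists_long_template (H := M \ T) (S := S)
    (U₀ := U₀) (L := (List.ofFn ℓ).filter (5 ≤ ·))
    (fun l hl => by simpa using (List.mem_filter.1 hl).2) (by omega) hLn
    (card_pos.1 (by omega)) (fun e he => (hMW e (hHM he)).1)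
    (fun e he e' he' => hdis e (hHM he) e' (hHM he'))
    (fun e he => disjoint_of_subset_left (hMW e (hHM he)).2 hWY) (fun e he => hMU e (hHM he))
    (disjoint_of_subset_left hUW hWY) (by omega) (by omega) (by omega)
  refine exists_two_factor_of_template hR.exp h3 hsum hflex (by omega) hch hnd hH hSc hUcs
    (rest := rest ++ (List.ofFn ℓ).filter fun x => !decide (5 ≤ x)) ?_
  rw [← List.append_assoc, hrest]
  exact hp

theorem sum_eq_count_add_filter (L : List ℕ) (hL : ∀ l ∈ L, 3 ≤ l) :
    L.sum = 3 * L.count 3 + 4 * L.count 4 + (L.filter (5 ≤ ·)).sum := by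
  induction L with
  | nil => simp
  | cons a L ih =>
    have h1 := ih fun l hl => hL l (List.mem_cons_of_mem _ hl)
    have h2 := hL a List.mem_cons_self
    rw [List.sum_cons, List.count_cons, List.count_cons, List.filter_cons]
    rcases Nat.lt_or_ge a 5 with h | h
    · interval_cases a <;> simp <;> omega
    · simp only [h, decide_true, if_true, List.sum_cons, beq_iff_eq]
      rw [if_neg (by omega), if_neg (by omega)]
      omega

end cases

section main

variable {V : Type} [Fintype V] [DecidableEq V] {G : SimpleGraph V} [DecidableRel G.Adj]
  {p lam ε δ : ℝ}

theorem Pseudorandom.scale_le (h : Pseudorandom G p lam ε) (hδ : 0 < δ) (hδ1 : δ ≤ 1)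
    (hε : ε ≤ δ / 200000) :
    200000 * (ε * p * Fintype.card V) ≤ δ * p * Fintype.card V ∧
      200000 * (ε * Fintype.card V) ≤ δ * Fintype.card V ∧
      ε * p * Fintype.card V ≤ ε * Fintype.card V ∧
      δ * p * Fintype.card V ≤ δ * Fintype.card V ∧
      δ * Fintype.card V ≤ (Fintype.card V : ℝ) := by
  have hn0 := h.card_pos
  have hp := h.p_pos
  have hp1 := h.p_le
  have hε0 := h.ε_pos
  set n : ℝ := (Fintype.card V : ℝ)
  have h1 : 200000 * (ε * p * n) ≤ δ * p * n := by
    have : 0 < p * n := by positivity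
    nlinarith
  have h2 : 200000 * (ε * n) ≤ δ * n := by nlinarith
  have h3 : ε * p * n ≤ ε * n := by
    have : 0 < ε * n := by positivity
    nlinarith
  have h4 : δ * p * n ≤ δ * n := by
    have : 0 < δ * n := by positivity
    nlinarith
  have h5 : δ * n ≤ n := by nlinarith
  exact ⟨h1, h2, h3, h4, h5⟩

theorem Pseudorandom.card_le_of_high_degree (h : Pseudorandom G p lam ε) (hδ : 0 < δ)
    (hε : ε ≤ δ / 200000) {X Q : Finset V} (hQ : (Q.card : ℝ) ≤ δ * Fintype.card V / 100)
    (hX : ∀ x ∈ X, δ * p * Fintype.card V / 50 ≤ (nb G x Q).card) :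
    (X.card : ℝ) ≤ ε * p * Fintype.card V := by
  have hn0 := h.card_pos
  have hp := h.p_pos
  have hp1 := h.p_le
  have hε0 := h.ε_pos
  have hlam := h.lam_sq_le
  set n : ℝ := (Fintype.card V : ℝ)
  have h1 := _root_.card_mul_sq_le_of_high_degree h.bij (X := X) (Q := Q) (D := δ * p * n / 50)
    (by positivity) (by nlinarith) hX
  have h2 : 4 * lam ^ 2 * Q.card ≤ 4 * (ε ^ 2 * p ^ 4 * n ^ 2) * (δ * n / 100) := by gcongr
  have h3 : (X.card : ℝ) * δ ≤ 100 * ε ^ 2 * p ^ 2 * n := by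
    have h4 : 0 < δ * p ^ 2 * n ^ 2 := by positivity
    refine le_of_mul_le_mul_left ?_ h4
    calc δ * p ^ 2 * n ^ 2 * (X.card * δ) = 2500 * (X.card * (δ * p * n / 50) ^ 2) := by ring
      _ ≤ 2500 * (4 * (ε ^ 2 * p ^ 4 * n ^ 2) * (δ * n / 100)) :=
          mul_le_mul_of_nonneg_left (h1.trans h2) (by norm_num)
      _ = _ := by ring
  have h4 : 100 * ε ^ 2 * p ^ 2 * n ≤ δ * (ε * p * n) := by
    have h5 : 0 < ε * p * n := by positivity
    have h6 : 100 * ε * p ≤ δ := by nlinarith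
    nlinarith
  refine le_of_mul_le_mul_left ?_ hδ
  linarith

theorem Pseudorandom.exists_reservoir (h : Pseudorandom G p lam ε) (hδ : 0 < δ) (hδ1 : δ ≤ 1)
    (hε : ε ≤ δ / 200000) (hlog : Real.log (Fintype.card V) ≤ ε * p * Fintype.card V)
    (hdeg : ∀ v, δ * p * Fintype.card V ≤ (G.degree v : ℝ)) {q : ℕ}
    (hq : (q : ℝ) ≤ δ * Fintype.card V / 100) :
    ∃ (d : ℕ) (Y₁ Y₂ : Finset V),
      Reservoir G ⌈3 * (ε * p * Fintype.card V)⌉₊ ⌈16 * (ε * Fintype.card V)⌉₊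
        ⌈δ * p * Fintype.card V / 50⌉₊ ⌈3 * (ε * p * Fintype.card V)⌉₊ q d Y₁ Y₂ ∧
      0.15 * (Fintype.card V : ℝ) ≤ (univ \ (Y₁ ∪ Y₂)).card := by
  have hn0 := h.card_pos
  have hp := h.p_pos
  have hp1 := h.p_le
  have hε0 := h.ε_pos
  have hbig := h.big
  have hlam := h.lam_sq_le
  have hexp := h.expands
  set n : ℝ := (Fintype.card V : ℝ) with hn
  obtain ⟨h1, h2, h3, h4, h5⟩ := h.scale_le hδ hδ1 hε
  rw [← hn] at h1 h2 h3 h4 h5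
  set a := ⌈δ * p * n⌉₊ with ha
  have ha1 : δ * p * n ≤ a := Nat.le_ceil _
  have han : a ≤ Fintype.card V := Nat.ceil_le.2 (h4.trans h5)
  have had : ∀ v, a ≤ G.degree v := fun v => Nat.ceil_le.2 (hdeg v)
  have hb' := (Nat.ceil_lt_add_one (a := 3 * (ε * p * n)) (by positivity)).le
  have hb := Nat.le_ceil (3 * (ε * p * n))
  have hy' := (Nat.ceil_lt_add_one (a := 16 * (ε * n)) (by positivity)).le
  have hD := Nat.le_ceil (δ * p * n / 50)
  have hD' := (Nat.ceil_lt_add_one (a := δ * p * n / 50) (by positivity)).le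
  set b := ⌈3 * (ε * p * n)⌉₊
  set y := ⌈16 * (ε * n)⌉₊
  set D := ⌈δ * p * n / 50⌉₊
  have hd₀ : (2 * a : ℝ) - 4 ≤ 5 * (2 * a / 5 : ℕ) := by
    have : 2 * a ≤ 5 * (2 * a / 5) + 4 := by omega
    have : (2 * a : ℝ) ≤ 5 * (2 * a / 5 : ℕ) + 4 := by exact_mod_cast this
    linarith
  have hd₁ : (2 * (2 * a / 5 : ℕ) : ℝ) - 4 ≤ 5 * (2 * (2 * a / 5) / 5 : ℕ) := by
    have : 2 * (2 * a / 5) ≤ 5 * (2 * (2 * a / 5) / 5) + 4 := by omega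
    have : (2 * (2 * a / 5 : ℕ) : ℝ) ≤ 5 * (2 * (2 * a / 5) / 5 : ℕ) + 4 := by exact_mod_cast this
    linarith
  have hsz : ∀ k : ℕ, 2 * (2 * Fintype.card V / 5) / 5 ≤ k → 0.15 * n ≤ k := fun k hk => by
    have : 4 * Fintype.card V ≤ 25 * k + 33 := by omega
    have : 4 * n ≤ 25 * k + 33 := by rw [hn]; exact_mod_cast this
    linarith
  obtain ⟨Y₁, Y₂, hdis, hd1, hd2, hs1, hs2, hs3⟩ := exists_split G (d := 2 * a / 5)
    (by
      have : (3 : ℝ) ≤ n := by linarith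
      rw [hn] at this
      exact_mod_cast this)
    (by linarith) (by omega) (fun v => by have := had v; omega)
  have hsize : ∀ Y : Finset V, 0.15 * n ≤ Y.card → 2 * q + 16 * b + 8 + y + b ≤ Y.card :=
    fun Y hY => by
      have : (2 * q + 16 * b + 8 + y + b : ℝ) ≤ Y.card := by linarith
      exact_mod_cast this
  refine ⟨_, Y₁, Y₂, ⟨hexp, ?_, hdis, hd1, hd2, ?_, hsize _ (hsz _ hs1), hsize _ (hsz _ hs2)⟩,
    hsz _ hs3⟩
  · intro X Q hQq hX
    have := h.card_le_of_high_degree hδ hε ((Nat.cast_le.2 hQq).trans hq)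
      fun x hx => hD.trans (by exact_mod_cast hX x hx)
    have : (X.card : ℝ) ≤ b := by linarith
    exact_mod_cast this
  · have : (2 * D + 2 * b + 40 * b : ℝ) ≤ (2 * (2 * a / 5) / 5 : ℕ) := by linarith
    exact_mod_cast this

theorem Pseudorandom.exists_two_factor (h : Pseudorandom G p lam ε) (hδ : 0 < δ) (hδ1 : δ ≤ 1)
    (hε : ε ≤ δ / 200000) {K : ℕ} (hK : 64000 / δ ≤ K) (hεK : 5600 * ε ^ 2 * 2 ^ K ≤ δ / 80000)
    (hlog : Real.log (Fintype.card V) ≤ ε * p * Fintype.card V)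
    (hdeg : ∀ v, δ * p * Fintype.card V ≤ (G.degree v : ℝ)) {t : ℕ}
    {ℓ : Fin t → ℕ} (h3 : ∀ i, 3 ≤ ℓ i) (hsum : ∑ i, ℓ i = Fintype.card V) :
    ∃ (v : Fin t → V) (c : ∀ i, G.Walk (v i) (v i)),
      (∀ i, (c i).IsCycle ∧ (c i).length = ℓ i) ∧
      (∀ i j, i ≠ j → Disjoint (c i).support.toFinset (c j).support.toFinset) ∧
      Finset.univ.biUnion (fun i => (c i).support.toFinset) = Finset.univ := by
  have hn0 := h.card_pos
  have hp := h.p_pos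
  have hp1 := h.p_le
  have hε0 := h.ε_pos
  have hbig := h.big
  have hη : 0 < δ / 80000 := by positivity
  set n : ℝ := (Fintype.card V : ℝ) with hn
  obtain ⟨g1, g2, g3, g4, g5⟩ := h.scale_le hδ hδ1 hε
  rw [← hn] at g1 g2 g3 g4 g5
  set m := ⌈δ * n / 2000⌉₊
  have hm : δ * n / 2000 ≤ m := Nat.le_ceil _
  have hm' : (m : ℝ) ≤ δ * n / 2000 + 1 := (Nat.ceil_lt_add_one (by positivity)).le
  obtain ⟨d, Y₁, Y₂, hR, hW⟩ := h.exists_reservoir hδ hδ1 hε hlog hdeg (q := 10 * m)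
    (by push_cast; linarith)
  have hb' := (Nat.ceil_lt_add_one (a := 3 * (ε * p * n)) (by positivity)).le
  have hy := Nat.le_ceil (16 * (ε * n))
  have hy' := (Nat.ceil_lt_add_one (a := 16 * (ε * n)) (by positivity)).le
  have hDs : ⌈δ / 80000 * p * n⌉₊ ≤ ⌈δ * p * n / 50⌉₊ := Nat.ceil_mono (by
    have : 0 < δ * p * n := by positivity
    linarith)
  set b := ⌈3 * (ε * p * n)⌉₊
  set y := ⌈16 * (ε * n)⌉₊
  set D := ⌈δ * p * n / 50⌉₊
  set s := ⌈δ / 80000 * n⌉₊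
  set s' := ⌈δ / 80000 * p * n⌉₊
  have hs : δ / 80000 * n ≤ s := Nat.le_ceil _
  have hs1 : (s : ℝ) ≤ δ / 80000 * n + 1 := (Nat.ceil_lt_add_one (by positivity)).le
  have hs' : δ / 80000 * p * n ≤ s' := Nat.le_ceil _
  have hss : s' ≤ s := Nat.ceil_mono (by linarith)
  have hsm : 20 * s ≤ m := by
    have : (20 * s : ℝ) ≤ m := by linarith
    exact_mod_cast this
  have hbm : 20 * b ≤ m := by
    have : (20 * b : ℝ) ≤ m := by linarith
    exact_mod_cast this
  have hym : 6 * y ≤ m := by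
    have : (6 * y : ℝ) ≤ m := by linarith
    exact_mod_cast this
  have hm1 : 100 ≤ m := by
    have : (100 : ℝ) ≤ m := by linarith
    exact_mod_cast this
  have hmn : 100 * m ≤ Fintype.card V := by
    have : 100 * (m : ℝ) ≤ n := by linarith
    rw [hn] at this
    exact_mod_cast this
  have hy0 : 0 < y := by
    have : (0 : ℝ) < y := by linarith
    exact_mod_cast this
  set W₀ := univ \ (Y₁ ∪ Y₂)
  have hWY : Disjoint W₀ (Y₁ ∪ Y₂) := sdiff_disjoint
  have hWm : 4 * m ≤ W₀.card := by
    have : (4 * m : ℝ) ≤ W₀.card := by linarith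
    exact_mod_cast this
  have hWn : n / 10 + 3 * m ≤ W₀.card := by linarith
  have hKz : Fintype.card V + m < K * (m / 8 + 1) := by
    have h1 : (m : ℝ) ≤ 8 * ((m / 8 + 1 : ℕ) : ℝ) := by
      have : m ≤ 8 * (m / 8 + 1) := by omega
      exact_mod_cast this
    have h2 : 4 * n ≤ K * ((m / 8 + 1 : ℕ) : ℝ) := by
      calc 4 * n = 64000 / δ * (δ * n / 16000) := by field_simp; norm_num
        _ ≤ K * ((m / 8 + 1 : ℕ) : ℝ) := by
            gcongr
            linarith
    have : ((Fintype.card V + m : ℕ) : ℝ) < ((K * (m / 8 + 1) : ℕ) : ℝ) := by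
      rw [Nat.cast_mul, Nat.cast_add]
      linarith
    exact_mod_cast this
  have hε1 : ε ≤ 1 / 1000 := by linarith
  by_cases hcount : ∃ l, (l = 3 ∨ l = 4) ∧ m + s ≤ (List.ofFn ℓ).count l
  · obtain ⟨l, hl, hcount⟩ := hcount
    obtain ⟨M, hM, hMW, hdis, hX⟩ := h.exists_edge_gadgets hη (by linarith) hs hε1 hεK hWn
    rw [← hM] at hX hKz hcount
    exact hR.exists_two_factor_of_count h3 hsum hl hcount hWY hMW hdis hX hKz
      (u := m / 2) (by omega) (by omega) (by omega) (by omega) hy0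
  · push Not at hcount
    obtain ⟨M, hM, hMW, hdis, hX⟩ := h.exists_pair_gadgets hη hs' hε1 hεK hWn
    have hc3 := hcount 3 (by simp)
    have hc4 := hcount 4 (by simp)
    have hL := sum_eq_count_add_filter (List.ofFn ℓ) fun l hl => by
      obtain ⟨i, rfl⟩ := (List.mem_ofFn' _ _).1 hl
      exact h3 i
    rw [List.sum_ofFn, hsum] at hL
    rw [← hM] at hX hKz
    exact hR.exists_two_factor_of_long h3 hsum (by omega) hWY hMW hdis hX hKz
      (u := m / 2) (by omega) (by omega) hDs (by omega) (by omega) hy0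

end main

/-- for every `δ > 0` there are `ε > 0` and `n₀` such that for every
`p ∈ (0,1]`, every `n ≥ n₀`, every `(p,λ)`-bijumbled graph `G` on `n` vertices with
`λ ≤ ε p² n / log n` and minimum degree at least `δ p n`, and every prescribed list of
cycle lengths `ℓ₁,…,ℓ_t ≥ 3` summing to `n`, `G` contains `t` vertex-disjoint cycles of
lengths `ℓ₁,…,ℓ_t` covering all vertices. -/
theorem stmt0 (δ : ℝ) (hδ : 0 < δ) :
    ∃ ε : ℝ, 0 < ε ∧ ∃ n₀ : ℕ, ∀ p : ℝ, 0 < p → p ≤ 1 → ∀ n : ℕ, n₀ ≤ n →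
    ∀ (V : Type) [Fintype V] [DecidableEq V] (G : SimpleGraph V) [DecidableRel G.Adj],
      Fintype.card V = n →
      ∀ lam : ℝ, lam ≤ ε * p ^ 2 * n / Real.log n → Bijumbled G p lam →
      (∀ v : V, δ * p * n ≤ (G.degree v : ℝ)) →
      ∀ (t : ℕ) (ℓ : Fin t → ℕ), (∀ i, 3 ≤ ℓ i) → ∑ i, ℓ i = n →
      ∃ (v : Fin t → V) (c : ∀ i, G.Walk (v i) (v i)),
        (∀ i, (c i).IsCycle ∧ (c i).length = ℓ i) ∧
        (∀ i j, i ≠ j → Disjoint (c i).support.toFinset (c j).support.toFinset) ∧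
        Finset.univ.biUnion (fun i => (c i).support.toFinset) = Finset.univ := by
  set δ' := min δ 1
  have hδ' : 0 < δ' := lt_min hδ one_pos
  have hδ1 : δ' ≤ 1 := min_le_right _ _
  obtain ⟨K, hK⟩ := exists_nat_ge (64000 / δ')
  set ε := min (δ' / 200000) (δ' / (80000 * (5600 * 2 ^ K))) with hεdef
  have hε : 0 < ε := by positivity
  have hε1 : ε ≤ δ' / 200000 := min_le_left _ _
  have hεK : 5600 * ε ^ 2 * 2 ^ K ≤ δ' / 80000 := by
    have h1 : ε * (80000 * (5600 * 2 ^ K)) ≤ δ' :=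
      (le_div_iff₀ (by positivity)).1 (min_le_right _ _)
    have h2 : ε ^ 2 ≤ ε := by nlinarith
    have h3 : (0 : ℝ) < 5600 * 2 ^ K := by positivity
    nlinarith
  refine ⟨ε, hε, ⌈Real.exp 100⌉₊, fun p hp hp1 n hn V _ _ G _ hV lam hlam hbij hdeg t ℓ h3 hsum => ?_⟩
  subst hV
  have hexp : Real.exp 100 ≤ Fintype.card V := Nat.ceil_le.1 hn
  have hn0 : (0 : ℝ) < Fintype.card V := (Real.exp_pos _).trans_le hexp
  have hlog : 100 ≤ Real.log (Fintype.card V) := (Real.le_log_iff_exp_le hn0).2 hexp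
  have : Nonempty V := Fintype.card_pos_iff.1 (by exact_mod_cast hn0)
  have hpl := hbij.lam_pos hp
  have hlam' := (le_div_iff₀ (by linarith)).1 hlam
  have hlogε : Real.log (Fintype.card V) ≤ ε * p * Fintype.card V := by
    refine le_of_mul_le_mul_left ?_ hp
    nlinarith
  have hP : Pseudorandom G p lam ε :=
    ⟨hbij, hp, hp1, hε, hp.trans hpl, by nlinarith, hlog.trans hlogε⟩
  refine hP.exists_two_factor hδ' hδ1 hε1 hK hεK hlogε (fun v => le_trans ?_ (hdeg v)) h3 hsum
  gcongr
  exact min_le_left _ _
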